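/- Let Assumption W* hold and let Assumption B̲_{{α_n}} hold for a sequence α_n ↑ 1. Define u(x) := liminf_{n→∞, y→x} u_{α_n}(y), the lower limit of (n,y) ↦ u_{α_n}(y) along the product of the atTop filter in n and the neighborhood filter of x. Then there exists a deterministic policy φ satisfying the WACOI with this function u; consequently φ is average-cost optimal. In addition, u is lower semicontinuous, and for every x ∈ X, w(x) = w^φ(x) = limsup_{n→∞} (1−α_n) v_{α_n}(x) = limsup_{α↑1} (1−α) v_α(x) = w̄ = w̄_{{α_n}} = w*. -/

import Mathlib

open MeasureTheory ProbabilityTheory Filter Topology Set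
open scoped ENNReal NNReal

noncomputable section

/-- The nonnegative part of an extended real, as an element of `ℝ≥0∞`. -/
def eToENN (x : EReal) : ℝ≥0∞ := if x = ⊤ then ⊤ else ENNReal.ofReal x.toReal

/-- Extended integral of an `EReal`-valued function: positive part minus negative part. -/
def eInt {Y : Type*} [MeasurableSpace Y] (μ : Measure Y) (f : Y → EReal) : EReal :=
  ((∫⁻ y, eToENN (f y) ∂μ : ℝ≥0∞) : EReal) - ((∫⁻ y, eToENN (-(f y)) ∂μ : ℝ≥0∞) : EReal)

/-- Extended sum of an `EReal`-valued series: positive part minus negative part. -/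
def eSum (f : ℕ → EReal) : EReal :=
  ((∑' t, eToENN (f t) : ℝ≥0∞) : EReal) - ((∑' t, eToENN (-(f t)) : ℝ≥0∞) : EReal)

/-- Histories of length `t`: `(X × A) ^ t × X`. -/
abbrev Hist (X A : Type*) (t : ℕ) := (Fin t → X × A) × X

/-- A (randomized, history-dependent) policy: a regular transition probability from
histories to actions, at every time epoch. -/
structure Policy (X A : Type*) [MeasurableSpace X] [MeasurableSpace A] where
  π : ∀ t : ℕ, Kernel (Hist X A t) A
  markov : ∀ t, IsMarkovKernel (π t)

/-- A Markov decision process with state space `X`, action space `A`, one-step cost `c`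
(measurable and bounded below, with values in `(-∞, +∞]`) and transition probability `q`. -/
structure MDP (X A : Type*) [MeasurableSpace X] [MeasurableSpace A] where
  c : X → A → EReal
  q : Kernel (X × A) X
  markov : IsMarkovKernel q
  c_meas : Measurable fun p : X × A => c p.1 p.2
  c_ne_bot : ∃ K : ℝ, ∀ x a, (K : EReal) ≤ c x a

variable {X A : Type*} [MeasurableSpace X] [MeasurableSpace A]

/-- The deterministic policy given by a measurable map `φ : X → A` applied to the current state. -/
def detPolicy (φ : X → A) (hφ : Measurable φ) : Policy X A :=
  ⟨fun t => Kernel.deterministic (fun h : Hist X A t => φ h.2) (hφ.comp measurable_snd),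
   fun _ => by infer_instance⟩

/-- The distribution `P_x^π` of the history `h_t`, constructed recursively
(Ionescu-Tulcea finite-dimensional marginals). -/
def histMeas (M : MDP X A) (p : Policy X A) (x : X) : ∀ t : ℕ, Measure (Hist X A t)
  | 0 => Measure.dirac (Fin.elim0, x)
  | (t + 1) =>
      (histMeas M p x t).bind fun h =>
        ((p.π t) h).bind fun a =>
          (M.q (h.2, a)).map fun x' => (Fin.snoc h.1 (h.2, a), x')

/-- The joint distribution of the state-action pair `(x_t, a_t)` under `P_x^π`. -/
def saMeas (M : MDP X A) (p : Policy X A) (x : X) (t : ℕ) : Measure (X × A) :=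
  (histMeas M p x t).bind fun h => ((p.π t) h).map fun a => (h.2, a)

/-- `E_x^π c(x_t, a_t)`. -/
def expCost (M : MDP X A) (p : Policy X A) (x : X) (t : ℕ) : EReal :=
  eInt (saMeas M p x t) fun sa => M.c sa.1 sa.2

/-- The expected total discounted cost `v_α^π(x) = E_x^π ∑_t α^t c(x_t, a_t)`. -/
def vDisc (M : MDP X A) (α : ℝ) (p : Policy X A) (x : X) : EReal :=
  eSum fun t => ((α ^ t : ℝ) : EReal) * expCost M p x t

/-- The finite-horizon expected total (undiscounted) cost `v_{N,1}^π(x)`. -/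
def vFin (M : MDP X A) (N : ℕ) (p : Policy X A) (x : X) : EReal :=
  ∑ t ∈ Finset.range N, expCost M p x t

/-- The discounted value function `v_α(x) = inf_π v_α^π(x)`. -/
def vDiscOpt (M : MDP X A) (α : ℝ) (x : X) : EReal :=
  ⨅ p : Policy X A, vDisc M α p x

/-- The average cost per unit time `w^π(x)`. -/
def avgCost (M : MDP X A) (p : Policy X A) (x : X) : EReal :=
  Filter.limsup (fun N : ℕ => (((N : ℝ)⁻¹ : ℝ) : EReal) * vFin M N p x) atTop

/-- The optimal average cost `w(x) = inf_π w^π(x)`. -/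
def avgOpt (M : MDP X A) (x : X) : EReal :=
  ⨅ p : Policy X A, avgCost M p x

/-- `w* = inf_x w(x)`. -/
def wStar (M : MDP X A) : EReal := ⨅ x : X, avgOpt M x

/-- `m_α = inf_x v_α(x)`. -/
def mDisc (M : MDP X A) (α : ℝ) : EReal := ⨅ x : X, vDiscOpt M α x

/-- The discounted relative value function `u_α(x) = v_α(x) - m_α`. -/
def uDisc (M : MDP X A) (α : ℝ) (x : X) : EReal := vDiscOpt M α x - mDisc M α

/-- `w̄ = limsup_{α↑1} (1-α) m_α`. -/
def wBar (M : MDP X A) : EReal :=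
  Filter.limsup (fun α : ℝ => ((1 - α : ℝ) : EReal) * mDisc M α) (𝓝[Set.Ico (0:ℝ) 1] 1)

/-- `w̲ = liminf_{α↑1} (1-α) m_α`. -/
def wLow (M : MDP X A) : EReal :=
  Filter.liminf (fun α : ℝ => ((1 - α : ℝ) : EReal) * mDisc M α) (𝓝[Set.Ico (0:ℝ) 1] 1)

/-- `w̄_{{α_n}} = limsup_n (1-α_n) m_{α_n}`. -/
def wBarSeq (M : MDP X A) (a : ℕ → ℝ) : EReal :=
  Filter.limsup (fun n : ℕ => ((1 - a n : ℝ) : EReal) * mDisc M (a n)) atTop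

/-- `w̲_{{α_n}} = liminf_n (1-α_n) m_{α_n}`. -/
def wLowSeq (M : MDP X A) (a : ℕ → ℝ) : EReal :=
  Filter.liminf (fun n : ℕ => ((1 - a n : ℝ) : EReal) * mDisc M (a n)) atTop

section TopologicalAssumptions

variable {X A : Type*} [MetricSpace X] [TopologicalSpace.SeparableSpace X]
  [MeasurableSpace X] [BorelSpace X] [StandardBorelSpace X]
  [MetricSpace A] [TopologicalSpace.SeparableSpace A]
  [MeasurableSpace A] [BorelSpace A] [StandardBorelSpace A]

/-- Assumption W*(i): the cost `c` is `K`-inf-compact, i.e., for every nonempty compact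
`K ⊆ X`, the restriction of `c` to `K × A` has compact sublevel sets. -/
def AssumptionWi (M : MDP X A) : Prop :=
  ∀ K : Set X, K.Nonempty → IsCompact K →
    ∀ lam : ℝ, IsCompact {p : X × A | p.1 ∈ K ∧ M.c p.1 p.2 ≤ (lam : EReal)}

/-- Assumption W*(ii): the transition probability `q(·|x,a)` is weakly continuous in `(x,a)`. -/
def AssumptionWii (M : MDP X A) : Prop :=
  ∀ f : BoundedContinuousFunction X ℝ, Continuous fun p : X × A => ∫ y, f y ∂ (M.q p)

/-- Assumption S*(i): for each `x`, the function `a ↦ c(x,a)` has compact sublevel sets. -/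
def AssumptionSi (M : MDP X A) : Prop :=
  ∀ x : X, ∀ lam : ℝ, IsCompact {a : A | M.c x a ≤ (lam : EReal)}

/-- Assumption S*(ii): for each `x`, the transition probability `q(·|x,a)` is setwise
continuous in `a`. -/
def AssumptionSii (M : MDP X A) : Prop :=
  ∀ x : X, ∀ B : Set X, MeasurableSet B → Continuous fun a : A => M.q (x, a) B

end TopologicalAssumptions

section Statements

variable {X A : Type*} [MetricSpace X] [TopologicalSpace.SeparableSpace X]
  [MeasurableSpace X] [BorelSpace X] [StandardBorelSpace X]
  [MetricSpace A] [TopologicalSpace.SeparableSpace A]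
  [MeasurableSpace A] [BorelSpace A] [StandardBorelSpace A]

/-- The function `u(x) = liminf_{n→∞, y→x} u_{α_n}(y)`: the lower limit of
`(n,y) ↦ u_{α_n}(y)` along the product of `atTop` and the neighborhood filter of `x`. -/
def uEqnOne (M : MDP X A) (a : ℕ → ℝ) (x : X) : EReal :=
  Filter.liminf (fun p : ℕ × X => uDisc M (a p.1) p.2) ((atTop : Filter ℕ) ×ˢ 𝓝 x)

section Semicontinuity

variable {P Y : Type*} [TopologicalSpace P] [TopologicalSpace Y] [MeasurableSpace Y]

theorem lowerSemicontinuous_lintegral_of_isOpen [FirstCountableTopology P]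
    [OpensMeasurableSpace Y] {μ : P → Measure Y}
    (hμ : ∀ G, IsOpen G → LowerSemicontinuous fun p => μ p G)
    {g : Y → ℝ≥0∞} (hg : LowerSemicontinuous g) :
    LowerSemicontinuous fun p => ∫⁻ y, g y ∂μ p := by
  have hgm : Measurable g := hg.measurable
  have trunc (p : P) : ∫⁻ y, g y ∂μ p = ⨆ n : ℕ, ∫⁻ y, min (g y) n ∂μ p := by
    rw [← lintegral_iSup (fun n => hgm.min measurable_const)
      (fun m n hmn y => min_le_min_left _ (by exact_mod_cast hmn))]
    refine lintegral_congr fun y => ?_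
    rw [← inf_iSup_eq, ENNReal.iSup_natCast, inf_top_eq]
  simp_rw [trunc]
  refine lowerSemicontinuous_iSup fun n => ?_
  have layer (p : P) : ∫⁻ y, min (g y) n ∂μ p
      = ∫⁻ t in Ioi (0 : ℝ), μ p {y | ENNReal.ofReal t < min (g y) n} := by
    have hlt (y : Y) : min (g y) n ≠ ⊤ := ne_top_of_le_ne_top (by simp) (min_le_right _ _)
    have := lintegral_eq_lintegral_meas_lt (μ p) (f := fun y => (min (g y) n).toReal)
      (ae_of_all _ fun y => ENNReal.toReal_nonneg)
      (hgm.min measurable_const).ennreal_toReal.aemeasurable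
    simp only [ENNReal.ofReal_toReal (hlt _)] at this
    rw [this]
    refine setLIntegral_congr_fun measurableSet_Ioi fun t ht => ?_
    simp only [ENNReal.ofReal_lt_iff_lt_toReal (mem_Ioi.1 ht).le (hlt _)]
  simp_rw [layer]
  rw [lowerSemicontinuous_iff_le_liminf]
  intro p
  refine le_trans (lintegral_mono fun t => ?_) (lintegral_liminf_le fun p' => ?_)
  · refine (lowerSemicontinuous_iff_le_liminf.1 (hμ _ ?_)) p
    exact LowerSemicontinuous.isOpen_preimage (hg.inf lowerSemicontinuous_const) _
  · refine Antitone.measurable fun s t hst => measure_mono fun y hy => ?_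
    exact lt_of_le_of_lt (ENNReal.ofReal_le_ofReal hst) hy

theorem lowerSemicontinuous_measure_of_continuous_integral [OpensMeasurableSpace Y]
    [HasOuterApproxClosed Y] {μ : P → Measure Y} (hprob : ∀ p, IsProbabilityMeasure (μ p))
    (hμ : ∀ f : BoundedContinuousFunction Y ℝ, Continuous fun p => ∫ y, f y ∂μ p)
    {G : Set Y} (hG : IsOpen G) : LowerSemicontinuous fun p => μ p G := by
  rw [lowerSemicontinuous_iff_le_liminf]
  intro p
  let ν : P → ProbabilityMeasure Y := fun p => ⟨μ p, hprob p⟩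
  have : Tendsto ν (𝓝 p) (𝓝 (ν p)) :=
    ProbabilityMeasure.tendsto_iff_forall_integral_tendsto.2 fun f => (hμ f).tendsto p
  exact ProbabilityMeasure.le_liminf_measure_open_of_tendsto this hG

/-- The largest lower semicontinuous minorant of `⨅ k ≥ n, f k`. -/
def tailEnvelope (f : ℕ → P → ℝ≥0∞) (n : ℕ) (x : P) : ℝ≥0∞ :=
  liminf (fun y => ⨅ k ≥ n, f k y) (𝓝 x)

theorem lowerSemicontinuous_tailEnvelope (f : ℕ → P → ℝ≥0∞) (n : ℕ) :
    LowerSemicontinuous (tailEnvelope f n) := by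
  intro x r hr
  obtain ⟨s, hrs, hs⟩ := exists_between hr
  have h := eventually_eventually_nhds.2 (eventually_lt_of_lt_liminf hs)
  filter_upwards [h] with y hy
  exact hrs.trans_le (le_liminf_of_le (h := hy.mono fun _ h => h.le))

theorem tailEnvelope_le (f : ℕ → P → ℝ≥0∞) {n k : ℕ} (hk : n ≤ k) (x : P) :
    tailEnvelope f n x ≤ f k x := by
  refine le_trans ?_ (iInf₂_le (f := fun k _ => f k x) k hk)
  refine liminf_le_of_le (h := fun b hb => ?_)
  exact hb.self_of_nhds

theorem monotone_tailEnvelope (f : ℕ → P → ℝ≥0∞) : Monotone (tailEnvelope f) := by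
  intro m n hmn x
  exact liminf_le_liminf (Eventually.of_forall fun y =>
    biInf_mono fun k hk => le_trans hmn hk)

theorem iSup_tailEnvelope (f : ℕ → P → ℝ≥0∞) (x : P) :
    ⨆ n, tailEnvelope f n x
      = liminf (fun p : ℕ × P => f p.1 p.2) ((atTop : Filter ℕ) ×ˢ 𝓝 x) := by
  apply le_antisymm
  · refine iSup_le fun n => le_of_forall_lt fun r hr => ?_
    obtain ⟨s, hrs, hs⟩ := exists_between hr
    refine hrs.trans_le (le_liminf_of_le (h := ?_))
    filter_upwards [(eventually_ge_atTop n).prod_mk (eventually_lt_of_lt_liminf hs)] with p hp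
    exact hp.2.le.trans (iInf₂_le p.1 hp.1)
  · refine le_of_forall_lt fun r hr => ?_
    obtain ⟨s, hrs, hs⟩ := exists_between hr
    obtain ⟨pa, ha, pb, hb, H⟩ := eventually_prod_iff.1 (eventually_lt_of_lt_liminf hs)
    obtain ⟨n, hn⟩ := eventually_atTop.1 ha
    refine hrs.trans_le (le_trans ?_ (le_iSup _ n))
    refine le_liminf_of_le (h := ?_)
    filter_upwards [hb] with y hy
    exact le_iInf₂ fun k hk => (H (hn k hk) hy).le

end Semicontinuity

section MeasurableSelection

/-- The minimizers of `g` over `D s`. -/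
def argminOn {S B : Type*} (D : S → Set B) (g : B → ℝ) (s : S) : Set B :=
  {b ∈ D s | ∀ b₀ ∈ D s, g b ≤ g b₀}

/-- Successive refinement of `D` by minimizing `g 0`, `g 1`, … lexicographically. -/
def lexArgmin {S B : Type*} (D : S → Set B) (g : ℕ → B → ℝ) : ℕ → S → Set B
  | 0 => D
  | n + 1 => argminOn (lexArgmin D g n) (g n)

variable {S B : Type*}

theorem isCompact_argminOn [TopologicalSpace B] {D : S → Set B} {g : B → ℝ} {s : S}
    (hD : IsCompact (D s)) (hg : Continuous g) : IsCompact (argminOn D g s) := by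
  have h : IsClosed {b | ∀ b' ∈ D s, g b ≤ g b'} := by
    simp only [ofPred_forall]
    exact isClosed_biInter fun b' _ => isClosed_le hg continuous_const
  exact hD.inter_right h

theorem nonempty_argminOn [TopologicalSpace B] {D : S → Set B} {g : B → ℝ} {s : S}
    (hD : IsCompact (D s)) (hne : (D s).Nonempty) (hg : Continuous g) :
    (argminOn D g s).Nonempty := by
  obtain ⟨b, hb, hmin⟩ := hD.exists_isMinOn hne hg.continuousOn
  exact ⟨b, hb, fun b' hb' => hmin hb'⟩

theorem measurableSet_argminOn_inter_nonempty [MeasurableSpace S] [TopologicalSpace B]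
    {D : S → Set B} {g : B → ℝ} (hD : ∀ s, IsCompact (D s)) (hg : Continuous g)
    (hm : ∀ F, IsClosed F → MeasurableSet {s | (D s ∩ F).Nonempty}) {F : Set B}
    (hF : IsClosed F) : MeasurableSet {s | (argminOn D g s ∩ F).Nonempty} := by
  have hle (r : ℝ) : IsClosed {b | g b ≤ r} := isClosed_le hg continuous_const
  have key : {s | (argminOn D g s ∩ F).Nonempty} = {s | (D s ∩ F).Nonempty} \
      ⋃ r : ℚ, {s | (D s ∩ {b | g b ≤ r}).Nonempty} \
        {s | (D s ∩ (F ∩ {b | g b ≤ r})).Nonempty} := by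
    ext s
    simp only [mem_ofPred_eq, Set.mem_sdiff, mem_iUnion, not_exists, not_and, not_not]
    constructor
    · rintro ⟨b, ⟨hb, hmin⟩, hbF⟩
      refine ⟨⟨b, hb, hbF⟩, ?_⟩
      rintro r ⟨b', hb', hr⟩
      exact ⟨b, hb, hbF, (hmin b' hb').trans hr⟩
    · rintro ⟨hne, h⟩
      obtain ⟨b, hb, hmin⟩ := ((hD s).inter_right hF).exists_isMinOn hne hg.continuousOn
      refine ⟨b, ⟨hb.1, fun b' hb' => ?_⟩, hb.2⟩
      by_contra! hlt
      obtain ⟨r, hr1, hr2⟩ := exists_rat_btwn hlt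
      obtain ⟨b'', h1, h2, h3⟩ := h r ⟨b', hb', hr1.le⟩
      have h4 : g b ≤ g b'' := hmin ⟨h1, h2⟩
      exact absurd (h4.trans h3) (not_le.2 hr2)
  rw [key]
  exact (hm F hF).diff (.iUnion fun r => (hm _ (hle r)).diff (hm _ (hF.inter (hle r))))

theorem lexArgmin_spec [MeasurableSpace S] [TopologicalSpace B] {D : S → Set B}
    {g : ℕ → B → ℝ} (hD : ∀ s, IsCompact (D s)) (hne : ∀ s, (D s).Nonempty)
    (hg : ∀ n, Continuous (g n))
    (hm : ∀ F, IsClosed F → MeasurableSet {s | (D s ∩ F).Nonempty}) (n : ℕ) :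
    (∀ s, IsCompact (lexArgmin D g n s)) ∧ (∀ s, (lexArgmin D g n s).Nonempty) ∧
      ∀ F, IsClosed F → MeasurableSet {s | (lexArgmin D g n s ∩ F).Nonempty} := by
  induction n with
  | zero => exact ⟨hD, hne, hm⟩
  | succ n ih =>
    obtain ⟨h1, h2, h3⟩ := ih
    exact ⟨fun s => isCompact_argminOn (h1 s) (hg n),
      fun s => nonempty_argminOn (h1 s) (h2 s) (hg n),
      fun F hF => measurableSet_argminOn_inter_nonempty h1 (hg n) h3 hF⟩

theorem measurable_of_measurable_dist [MeasurableSpace S] [PseudoMetricSpace B]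
    [MeasurableSpace B] [BorelSpace B] {φ : S → B} {d : ℕ → B} (hd : DenseRange d)
    (h : ∀ n, Measurable fun s => dist (φ s) (d n)) : Measurable φ := by
  refine measurable_of_isOpen fun G hG => ?_
  have key : φ ⁻¹' G = ⋃ (p : ℕ × ℚ) (_ : Metric.ball (d p.1) p.2 ⊆ G),
      {s | dist (φ s) (d p.1) < p.2} := by
    ext s
    simp only [mem_preimage, mem_iUnion, mem_ofPred_eq, exists_prop]
    constructor
    · intro hs
      obtain ⟨ε, hε, hball⟩ := Metric.isOpen_iff.1 hG _ hs
      obtain ⟨n, hn⟩ := hd.exists_dist_lt (φ s) (half_pos hε)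
      obtain ⟨r, hr1, hr2⟩ := exists_rat_btwn hn
      refine ⟨(n, r), fun b hb => hball ?_, hr1⟩
      have := dist_triangle b (d n) (φ s)
      rw [dist_comm (d n)] at this
      rw [Metric.mem_ball] at hb ⊢
      simp only at hb
      linarith
    · rintro ⟨p, hp, hs⟩
      exact hp hs
  rw [key]
  exact .iUnion fun p => .iUnion fun _ => measurableSet_lt (h p.1) measurable_const

/-- A compact-valued weakly measurable correspondence has a measurable selector. -/
theorem exists_measurable_selector [MeasurableSpace S] [MetricSpace B]
    [TopologicalSpace.SeparableSpace B] [MeasurableSpace B] [BorelSpace B] {D : S → Set B}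
    (hD : ∀ s, IsCompact (D s)) (hne : ∀ s, (D s).Nonempty)
    (hm : ∀ F, IsClosed F → MeasurableSet {s | (D s ∩ F).Nonempty}) :
    ∃ φ : S → B, Measurable φ ∧ ∀ s, φ s ∈ D s := by
  rcases isEmpty_or_nonempty S with hS | ⟨⟨s₀⟩⟩
  · exact ⟨fun s => hS.elim s, measurable_of_empty _, fun s => hS.elim s⟩
  have : Nonempty B := ⟨(hne s₀).some⟩
  obtain ⟨d, hd⟩ := TopologicalSpace.exists_dense_seq B
  let g : ℕ → B → ℝ := fun n b => dist b (d n)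
  have spec := lexArgmin_spec (g := g) hD hne (fun n => continuous_id.dist continuous_const) hm
  have hinter (s : S) : (⋂ n, lexArgmin D g n s).Nonempty :=
    IsCompact.nonempty_iInter_of_sequence_nonempty_isCompact_isClosed _
      (fun n b hb => hb.1) (fun n => (spec n).2.1 s) (hD s)
      fun n => ((spec n).1 s).isClosed
  choose φ hφ using hinter
  simp only [mem_iInter] at hφ
  refine ⟨φ, measurable_of_measurable_dist hd fun n => measurable_of_Iic fun r => ?_,
    fun s => hφ s 0⟩
  have key : (fun s => dist (φ s) (d n)) ⁻¹' Iic r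
      = {s | (lexArgmin D g (n + 1) s ∩ {b | g n b ≤ r}).Nonempty} := by
    ext s
    constructor
    · exact fun hs => ⟨φ s, hφ s (n + 1), hs⟩
    · rintro ⟨b, hb, hr⟩
      exact ((hφ s (n + 1)).2 b hb.1).trans hr
  rw [key]
  exact (spec (n + 1)).2.2 _ (isClosed_le (continuous_id.dist continuous_const) continuous_const)

/-- An inf-compact function which gets arbitrarily close to (or below) a measurable finite level
can be kept below that level by a measurable choice of its second argument. -/
theorem exists_measurable_le_of_infCompact [MetricSpace S] [MeasurableSpace S] [BorelSpace S]
    [MetricSpace B] [TopologicalSpace.SeparableSpace B] [MeasurableSpace B] [BorelSpace B]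
    {f : S → B → ℝ≥0∞} {g : S → ℝ≥0∞}
    (hf : ∀ K : Set S, IsCompact K → ∀ r : ℝ≥0∞, r < ⊤ →
      IsCompact {p : S × B | p.1 ∈ K ∧ f p.1 p.2 ≤ r})
    (hg : Measurable g) (hgt : ∀ s, g s < ⊤) (h : ∀ s, ∀ r > g s, ∃ b, f s b ≤ r) :
    ∃ φ : S → B, Measurable φ ∧ ∀ s, f s (φ s) ≤ g s := by
  have hcomp (s : S) {r : ℝ≥0∞} (hr : r < ⊤) : IsCompact {b | f s b ≤ r} := by
    convert (hf {s} isCompact_singleton r hr).image continuous_snd using 1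
    ext b
    simp
  have hclosed {F : Set B} (hF : IsClosed F) {r : ℝ≥0∞} (hr : r < ⊤) :
      IsClosed {s | ∃ b ∈ F, f s b ≤ r} := by
    refine IsSeqClosed.isClosed fun x x₀ hx hlim => ?_
    have hT := ((hf _ hlim.isCompact_insert_range r hr).inter_right
      (hF.preimage continuous_snd)).image continuous_fst
    obtain ⟨p, ⟨⟨-, h1⟩, h2⟩, rfl⟩ : x₀ ∈ Prod.fst ''
        ({p : S × B | p.1 ∈ insert x₀ (range x) ∧ f p.1 p.2 ≤ r} ∩ Prod.snd ⁻¹' F) := by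
      refine hT.isClosed.mem_of_tendsto hlim (Eventually.of_forall fun n => ?_)
      obtain ⟨b, hb, hle⟩ := hx n
      exact ⟨(x n, b), ⟨⟨mem_insert_of_mem _ ⟨n, rfl⟩, hle⟩, hb⟩, rfl⟩
    exact ⟨p.2, h2, h1⟩
  have attained {F : Set B} (hF : IsClosed F) (s : S)
      (hs : ∀ q : ℚ, g s < ENNReal.ofReal q → ∃ b ∈ F, f s b ≤ ENNReal.ofReal q) :
      ({b | f s b ≤ g s} ∩ F).Nonempty := by
    have : Nonempty {q : ℚ // g s < ENNReal.ofReal q} := by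
      obtain ⟨q, -, hq, -⟩ := ENNReal.lt_iff_exists_rat_btwn.1 (hgt s)
      exact ⟨q, hq⟩
    have hc (q : {q : ℚ // g s < ENNReal.ofReal q}) :
        IsCompact ({b | f s b ≤ ENNReal.ofReal (q : ℚ)} ∩ F) :=
      (hcomp s ENNReal.ofReal_lt_top).inter_right hF
    obtain ⟨b, hb⟩ := IsCompact.nonempty_iInter_of_directed_nonempty_isCompact_isClosed
      (fun q : {q : ℚ // g s < ENNReal.ofReal q} => {b | f s b ≤ ENNReal.ofReal (q : ℚ)} ∩ F)
      (fun q q' => by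
        rcases le_total (q : ℚ) q' with hqq | hqq
        · exact ⟨q, subset_rfl, fun b hb => ⟨hb.1.trans
            (ENNReal.ofReal_le_ofReal (by exact_mod_cast hqq)), hb.2⟩⟩
        · exact ⟨q', fun b hb => ⟨hb.1.trans
            (ENNReal.ofReal_le_ofReal (by exact_mod_cast hqq)), hb.2⟩, subset_rfl⟩)
      (fun q => by
        obtain ⟨b, hb, hle⟩ := hs q q.2
        exact ⟨b, hle, hb⟩) hc (fun q => (hc q).isClosed)
    simp only [mem_iInter, mem_inter_iff, mem_ofPred_eq] at hb
    refine ⟨b, show f s b ≤ g s from le_of_forall_gt fun r hr => ?_,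
      (hb (Classical.arbitrary _)).2⟩
    obtain ⟨q, -, hq1, hq2⟩ := ENNReal.lt_iff_exists_rat_btwn.1 hr
    exact (hb ⟨q, hq1⟩).1.trans_lt hq2
  obtain ⟨φ, hφ, hmem⟩ := exists_measurable_selector (D := fun s => {b | f s b ≤ g s})
    (fun s => hcomp s (hgt s))
    (fun s => by
      obtain ⟨b, hb⟩ := attained isClosed_univ s fun q hq => by
        obtain ⟨b, hb⟩ := h s _ hq
        exact ⟨b, trivial, hb⟩
      exact ⟨b, hb.1⟩)
    (fun F hF => by
      have key : {s | ({b | f s b ≤ g s} ∩ F).Nonempty} = ⋂ q : ℚ,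
          {s | ENNReal.ofReal q ≤ g s} ∪ {s | ∃ b ∈ F, f s b ≤ ENNReal.ofReal q} := by
        ext s
        simp only [mem_iInter, mem_union, mem_ofPred_eq]
        constructor
        · rintro ⟨b, hb, hbF⟩ q
          rcases le_or_gt (ENNReal.ofReal q) (g s) with hq | hq
          · exact .inl hq
          · exact .inr ⟨b, hbF, le_trans hb hq.le⟩
        · exact fun H => attained hF s fun q hq => (H q).resolve_left (not_le.2 hq)
      rw [key]
      exact .iInter fun q => (measurableSet_le measurable_const hg).union
        (hclosed hF ENNReal.ofReal_lt_top).measurableSet)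
  exact ⟨φ, hφ, hmem⟩

end MeasurableSelection

section MeasureValuedMaps

variable {S B T : Type*} [MeasurableSpace S] [MeasurableSpace B] [MeasurableSpace T]

theorem ProbabilityTheory.Kernel.measurable_map_prodMk (κ : Kernel S B) [IsSFiniteKernel κ]
    {f : S × B → T} (hf : Measurable f) :
    Measurable fun s => (κ s).map fun b => f (s, b) := by
  refine Measure.measurable_of_measurable_coe _ fun G hG => ?_
  have (s : S) : (κ s).map (fun b => f (s, b)) G = κ s (Prod.mk s ⁻¹' (f ⁻¹' G)) :=
    Measure.map_apply (hf.comp measurable_prodMk_left) hG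
  simp_rw [this]
  exact Kernel.measurable_kernel_prodMk_left (hf hG)

theorem ProbabilityTheory.Kernel.measurable_bind_prodMk (κ : Kernel S B) [IsSFiniteKernel κ]
    {η : S × B → Measure T} (hη : Measurable η) :
    Measurable fun s => (κ s).bind fun b => η (s, b) := by
  refine Measure.measurable_of_measurable_coe _ fun G hG => ?_
  have (s : S) : (κ s).bind (fun b => η (s, b)) G = ∫⁻ b, η (s, b) G ∂κ s :=
    Measure.bind_apply hG (hη.comp measurable_prodMk_left).aemeasurable
  simp_rw [this]
  exact Measurable.lintegral_kernel_prod_right' ((Measure.measurable_coe hG).comp hη)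

theorem measurable_fin_snoc (t : ℕ) :
    Measurable fun p : (Fin t → S) × S => (Fin.snoc p.1 p.2 : Fin (t + 1) → S) := by
  refine measurable_pi_iff.2 fun i => ?_
  induction i using Fin.lastCases with
  | last => simpa using measurable_snd
  | cast i =>
    simp only [Fin.snoc_castSucc]
    exact (measurable_pi_apply i).comp measurable_fst

theorem measurable_fin_cons (t : ℕ) :
    Measurable fun p : S × (Fin t → S) => (Fin.cons p.1 p.2 : Fin (t + 1) → S) := by
  refine measurable_pi_iff.2 fun i => ?_
  induction i using Fin.cases with
  | zero => simpa using measurable_fst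
  | succ i =>
    simp only [Fin.cons_succ]
    exact (measurable_pi_apply i).comp measurable_snd

end MeasureValuedMaps

section HistoryExtension

variable {S B : Type*}

/-- The history `h` extended by the action `a` and the next state `y`. -/
def Hist.extend {t : ℕ} (h : Hist S B t) (a : B) (y : S) : Hist S B (t + 1) :=
  (Fin.snoc h.1 (h.2, a), y)

/-- The history `h` preceded by the state-action pair `z`. -/
def Hist.precede {t : ℕ} (z : S × B) (h : Hist S B t) : Hist S B (t + 1) :=
  (Fin.cons z h.1, h.2)

theorem Hist.precede_extend {t : ℕ} (z : S × B) (h : Hist S B t) (a : B) (y : S) :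
    (h.extend a y).precede z = (h.precede z).extend a y := by
  simp only [Hist.precede, Hist.extend, Fin.cons_snoc_eq_snoc_cons]

end HistoryExtension

section HistoryMeasures

variable {S B : Type*} [MeasurableSpace S] [MeasurableSpace B]

instance (p : Policy S B) (t : ℕ) : IsMarkovKernel (p.π t) := p.markov t

instance (M : MDP S B) : IsMarkovKernel M.q := M.markov

theorem Hist.measurable_extend (t : ℕ) :
    Measurable fun p : (Hist S B t × B) × S => p.1.1.extend p.1.2 p.2 :=
  ((measurable_fin_snoc t).comp ((measurable_fst.fst.fst).prodMk
    (measurable_fst.fst.snd.prodMk measurable_fst.snd))).prodMk measurable_snd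

theorem Hist.measurable_precede (t : ℕ) :
    Measurable fun p : (S × B) × Hist S B t => p.2.precede p.1 :=
  ((measurable_fin_cons t).comp (measurable_fst.prodMk measurable_snd.fst)).prodMk
    measurable_snd.snd

theorem measurable_pairWithState (t : ℕ) :
    Measurable fun p : Hist S B t × B => (p.1.2, p.2) :=
  measurable_fst.snd.prodMk measurable_snd

variable (M : MDP S B) (p : Policy S B)

theorem measurable_extendMeasure (t : ℕ) :
    Measurable fun z : Hist S B t × B => (M.q (z.1.2, z.2)).map (z.1.extend z.2) :=
  Kernel.measurable_map_prodMk (M.q.comap _ (measurable_pairWithState t))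
    (Hist.measurable_extend t)

theorem measurable_stepMeasure (t : ℕ) :
    Measurable fun h : Hist S B t =>
      (p.π t h).bind fun a => (M.q (h.2, a)).map (h.extend a) :=
  Kernel.measurable_bind_prodMk (p.π t)
    (η := fun z : Hist S B t × B => (M.q (z.1.2, z.2)).map (z.1.extend z.2))
    (measurable_extendMeasure M t)

/-- The conditional expectation of `g (h_{t+1})` given `h_t = h`. -/
def condNext {t : ℕ} (g : Hist S B (t + 1) → ℝ≥0∞) (h : Hist S B t) : ℝ≥0∞ :=
  ∫⁻ a, ∫⁻ y, g (h.extend a y) ∂M.q (h.2, a) ∂p.π t h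

variable {M p}

theorem measurable_lintegral_extend {t : ℕ} {g : Hist S B (t + 1) → ℝ≥0∞} (hg : Measurable g) :
    Measurable fun z : Hist S B t × B => ∫⁻ y, g (z.1.extend z.2 y) ∂M.q (z.1.2, z.2) :=
  Measurable.lintegral_kernel_prod_right' (κ := M.q.comap _ (measurable_pairWithState t))
    (hg.comp (Hist.measurable_extend t))

theorem measurable_condNext {t : ℕ} {g : Hist S B (t + 1) → ℝ≥0∞} (hg : Measurable g) :
    Measurable (condNext M p g) :=
  Measurable.lintegral_kernel_prod_right' (measurable_lintegral_extend hg)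

theorem lintegral_histMeas_zero {g : Hist S B 0 → ℝ≥0∞} (hg : Measurable g) (x : S) :
    ∫⁻ h, g h ∂histMeas M p x 0 = g (Fin.elim0, x) :=
  lintegral_dirac' _ hg

theorem lintegral_histMeas_succ {t : ℕ} {g : Hist S B (t + 1) → ℝ≥0∞} (hg : Measurable g)
    (x : S) :
    ∫⁻ h, g h ∂histMeas M p x (t + 1) = ∫⁻ h, condNext M p g h ∂histMeas M p x t := by
  change ∫⁻ h, g h ∂(histMeas M p x t).bind (fun h =>
    (p.π t h).bind fun a => (M.q (h.2, a)).map (h.extend a)) = _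
  rw [Measure.lintegral_bind (measurable_stepMeasure M p t).aemeasurable hg.aemeasurable]
  refine lintegral_congr fun h => ?_
  have hm := (measurable_extendMeasure M t).comp (measurable_prodMk_left (x := h))
  rw [Measure.lintegral_bind (m := p.π t h)
    (μ := fun a => (M.q (h.2, a)).map (h.extend a)) hm.aemeasurable hg.aemeasurable]
  refine lintegral_congr fun a => ?_
  exact lintegral_map hg ((Hist.measurable_extend t).comp (measurable_prodMk_left (x := (h, a))))

theorem isProbabilityMeasure_histMeas (x : S) (t : ℕ) :
    IsProbabilityMeasure (histMeas M p x t) := by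
  induction t with
  | zero => exact Measure.dirac.isProbabilityMeasure
  | succ t ih =>
    refine ⟨?_⟩
    rw [← lintegral_one, lintegral_histMeas_succ measurable_const]
    simp [condNext]

theorem lintegral_saMeas {g : S × B → ℝ≥0∞} (hg : Measurable g) (x : S) (t : ℕ) :
    ∫⁻ z, g z ∂saMeas M p x t
      = ∫⁻ h, ∫⁻ a, g (h.2, a) ∂p.π t h ∂histMeas M p x t := by
  have hm := Kernel.measurable_map_prodMk (p.π t) (measurable_pairWithState t)
  rw [saMeas, Measure.lintegral_bind hm.aemeasurable hg.aemeasurable]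
  refine lintegral_congr fun h => ?_
  exact lintegral_map hg ((measurable_pairWithState t).comp measurable_prodMk_left)

theorem isProbabilityMeasure_saMeas (x : S) (t : ℕ) :
    IsProbabilityMeasure (saMeas M p x t) := by
  have := isProbabilityMeasure_histMeas (M := M) (p := p) x t
  refine ⟨?_⟩
  rw [← lintegral_one, lintegral_saMeas measurable_const]
  simp

/-- The policy followed by `p` after the initial state-action pair `z`. -/
def Policy.shift (p : Policy S B) (z : S × B) : Policy S B where
  π t := (p.π (t + 1)).comap (Hist.precede z)
    ((Hist.measurable_precede t).comp measurable_prodMk_left)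
  markov _ := Kernel.IsMarkovKernel.comap _ _

theorem condNext_shift {t : ℕ} (g : Hist S B (t + 2) → ℝ≥0∞) (z : S × B) (h : Hist S B t) :
    condNext M (p.shift z) (fun h => g (h.precede z)) h = condNext M p g (h.precede z) := by
  simp only [condNext, Policy.shift, Hist.precede_extend, Kernel.comap_apply]
  rfl

theorem lintegral_histMeas_shift_succ {t : ℕ} {g : Hist S B (t + 2) → ℝ≥0∞}
    (hg : Measurable g) (z : S × B) (y : S) :
    ∫⁻ h, g (h.precede z) ∂histMeas M (p.shift z) y (t + 1)
      = ∫⁻ h, condNext M p g (h.precede z) ∂histMeas M (p.shift z) y t := by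
  rw [lintegral_histMeas_succ (g := fun h => g (h.precede z))
    (hg.comp ((Hist.measurable_precede _).comp measurable_prodMk_left))]
  exact lintegral_congr fun h => condNext_shift g z h

theorem measurable_lintegral_histMeas_shift {t : ℕ} {g : Hist S B (t + 1) → ℝ≥0∞}
    (hg : Measurable g) :
    Measurable fun w : (S × B) × S =>
      ∫⁻ h, g (h.precede w.1) ∂histMeas M (p.shift w.1) w.2 t := by
  induction t with
  | zero =>
    have (w : (S × B) × S) : ∫⁻ h, g (h.precede w.1) ∂histMeas M (p.shift w.1) w.2 0
        = g (Hist.precede w.1 (Fin.elim0, w.2)) :=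
      lintegral_histMeas_zero
        (hg.comp ((Hist.measurable_precede _).comp measurable_prodMk_left)) _
    simp_rw [this]
    exact hg.comp ((Hist.measurable_precede 0).comp
      (measurable_fst.prodMk (measurable_const.prodMk measurable_snd)))
  | succ t ih =>
    simp_rw [lintegral_histMeas_shift_succ hg]
    exact ih (measurable_condNext hg)

/-- The Markov property at time one. -/
theorem lintegral_histMeas_succ_eq_shift {t : ℕ} {g : Hist S B (t + 1) → ℝ≥0∞}
    (hg : Measurable g) (x : S) :
    ∫⁻ h, g h ∂histMeas M p x (t + 1)
      = ∫⁻ a, ∫⁻ y, ∫⁻ h, g (h.precede (x, a)) ∂histMeas M (p.shift (x, a)) y t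
          ∂M.q (x, a) ∂p.π 0 (Fin.elim0, x) := by
  induction t with
  | zero =>
    rw [lintegral_histMeas_succ hg, lintegral_histMeas_zero (measurable_condNext hg), condNext]
    refine lintegral_congr fun a => lintegral_congr fun y => ?_
    rw [lintegral_histMeas_zero (g := fun h => g (h.precede (x, a)))
      (hg.comp ((Hist.measurable_precede _).comp measurable_prodMk_left))]
    congr 1
    refine Prod.ext (funext fun i => ?_) rfl
    rw [Subsingleton.elim (α := Fin 1) i (Fin.last 0)]
    simp only [Hist.extend, Fin.snoc_last]
    rfl
  | succ t ih =>
    rw [lintegral_histMeas_succ hg, ih (measurable_condNext hg)]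
    simp_rw [lintegral_histMeas_shift_succ hg]

end HistoryMeasures

section DiscountedCosts

variable {S B : Type*} [MeasurableSpace S] [MeasurableSpace B]

/-- The expected value at time `t` of a nonnegative cost `C`. -/
def stageCost (M : MDP S B) (C : S × B → ℝ≥0∞) (p : Policy S B) (x : S) (t : ℕ) : ℝ≥0∞ :=
  ∫⁻ z, C z ∂saMeas M p x t

/-- The expected total discounted value of a nonnegative cost `C`. -/
def discCost (M : MDP S B) (C : S × B → ℝ≥0∞) (β : ℝ≥0∞) (p : Policy S B) (x : S) : ℝ≥0∞ :=
  ∑' t, β ^ t * stageCost M C p x t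

/-- The discounted value function of a nonnegative cost `C`. -/
def discVal (M : MDP S B) (C : S × B → ℝ≥0∞) (β : ℝ≥0∞) (x : S) : ℝ≥0∞ :=
  ⨅ p : Policy S B, discCost M C β p x

/-- The discounted relative value function of a nonnegative cost `C`. -/
def discRel (M : MDP S B) (C : S × B → ℝ≥0∞) (β : ℝ≥0∞) (x : S) : ℝ≥0∞ :=
  discVal M C β x - ⨅ y, discVal M C β y

variable {M : MDP S B} {C : S × B → ℝ≥0∞} {p : Policy S B}

theorem measurable_lintegral_action (hC : Measurable C) (t : ℕ) :
    Measurable fun h : Hist S B t => ∫⁻ a, C (h.2, a) ∂p.π t h :=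
  Measurable.lintegral_kernel_prod_right' (κ := p.π t) (hC.comp (measurable_pairWithState t))

theorem stageCost_zero (hC : Measurable C) (x : S) :
    stageCost M C p x 0 = ∫⁻ a, C (x, a) ∂p.π 0 (Fin.elim0, x) := by
  rw [stageCost, lintegral_saMeas hC, lintegral_histMeas_zero (measurable_lintegral_action hC 0)]

theorem stageCost_shift (hC : Measurable C) (z : S × B) (y : S) (t : ℕ) :
    stageCost M C (p.shift z) y t
      = ∫⁻ h, (fun h' : Hist S B (t + 1) => ∫⁻ a, C (h'.2, a) ∂p.π (t + 1) h') (h.precede z)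
          ∂histMeas M (p.shift z) y t := by
  rw [stageCost, lintegral_saMeas hC]
  rfl

theorem stageCost_succ (hC : Measurable C) (x : S) (t : ℕ) :
    stageCost M C p x (t + 1)
      = ∫⁻ a, ∫⁻ y, stageCost M C (p.shift (x, a)) y t ∂M.q (x, a) ∂p.π 0 (Fin.elim0, x) := by
  simp_rw [stageCost_shift hC]
  rw [stageCost, lintegral_saMeas hC,
    lintegral_histMeas_succ_eq_shift (measurable_lintegral_action hC (t + 1))]

theorem measurable_stageCost_shift (hC : Measurable C) (t : ℕ) :
    Measurable fun w : (S × B) × S => stageCost M C (p.shift w.1) w.2 t := by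
  simp_rw [stageCost_shift hC]
  exact measurable_lintegral_histMeas_shift (measurable_lintegral_action hC (t + 1))

theorem measurable_stageCost_shift_left (hC : Measurable C) (x : S) (t : ℕ) :
    Measurable fun w : B × S => stageCost M C (p.shift (x, w.1)) w.2 t :=
  Measurable.comp (g := fun w : (S × B) × S => stageCost M C (p.shift w.1) w.2 t)
    (f := fun w : B × S => ((x, w.1), w.2)) (measurable_stageCost_shift hC t)
    ((measurable_const.prodMk measurable_fst).prodMk measurable_snd)

theorem measurable_stageCost_shift_right (hC : Measurable C) (z : S × B) (t : ℕ) :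
    Measurable fun y : S => stageCost M C (p.shift z) y t :=
  Measurable.comp (g := fun w : (S × B) × S => stageCost M C (p.shift w.1) w.2 t)
    (f := fun y : S => (z, y)) (measurable_stageCost_shift hC t) measurable_prodMk_left

theorem measurable_lintegral_stageCost_shift (hC : Measurable C) (x : S) (t : ℕ) :
    Measurable fun a : B => ∫⁻ y, stageCost M C (p.shift (x, a)) y t ∂M.q (x, a) :=
  Measurable.lintegral_kernel_prod_right' (κ := M.q.comap _ (measurable_prodMk_left (x := x)))
    (f := fun w : B × S => stageCost M C (p.shift (x, w.1)) w.2 t)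
    (measurable_stageCost_shift_left hC x t)

theorem lintegral_discCost_shift (hC : Measurable C) (β : ℝ≥0∞) (z : S × B) :
    ∫⁻ y, discCost M C β (p.shift z) y ∂M.q z
      = ∑' t, β ^ t * ∫⁻ y, stageCost M C (p.shift z) y t ∂M.q z := by
  simp only [discCost]
  rw [lintegral_tsum fun t =>
    ((measurable_stageCost_shift_right hC z t).const_mul (β ^ t)).aemeasurable]
  exact tsum_congr fun t => lintegral_const_mul _ (measurable_stageCost_shift_right hC z t)

theorem discCost_eq_lintegral (hC : Measurable C) (β : ℝ≥0∞) (x : S) :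
    discCost M C β p x
      = ∫⁻ a, (C (x, a) + β * ∫⁻ y, discCost M C β (p.shift (x, a)) y ∂M.q (x, a))
          ∂p.π 0 (Fin.elim0, x) := by
  have hm (t : ℕ) := measurable_lintegral_stageCost_shift (M := M) (p := p) hC x t
  have hC' : Measurable fun a => C (x, a) := hC.comp measurable_prodMk_left
  simp_rw [lintegral_discCost_shift hC]
  rw [lintegral_add_left hC', discCost, tsum_eq_zero_add' ENNReal.summable, pow_zero, one_mul,
    stageCost_zero hC]
  congr 1
  simp_rw [← ENNReal.tsum_mul_left]
  rw [lintegral_tsum fun t => (((hm t).const_mul (β ^ t)).const_mul β).aemeasurable]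
  refine tsum_congr fun t => ?_
  rw [lintegral_const_mul _ ((hm t).const_mul (β ^ t)), lintegral_const_mul _ (hm t),
    stageCost_succ hC, pow_succ', mul_assoc]

theorem iInf_le_discVal (hC : Measurable C) (β : ℝ≥0∞) (x : S) :
    ⨅ a, (C (x, a) + β * ∫⁻ y, discVal M C β y ∂M.q (x, a)) ≤ discVal M C β x := by
  refine le_iInf fun p => ?_
  rw [discCost_eq_lintegral hC]
  refine (iInf_le_lintegral _).trans (lintegral_mono fun a => ?_)
  gcongr
  exact iInf_le _ _

theorem discRel_add_iInf (β : ℝ≥0∞) (x : S) :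
    discRel M C β x + ⨅ y, discVal M C β y = discVal M C β x :=
  tsub_add_cancel_of_le (iInf_le _ x)

theorem iInf_le_discRel (hC : Measurable C) {β δ : ℝ≥0∞} (h : β + δ = 1)
    (hm : ⨅ y, discVal M C β y ≠ ⊤) (x : S) :
    ⨅ a, (C (x, a) + β * ∫⁻ y, discRel M C β y ∂M.q (x, a))
      ≤ discRel M C β x + δ * ⨅ y, discVal M C β y := by
  have hx := iInf_le_discVal (M := M) hC β x
  set m := ⨅ y, discVal M C β y
  have hβ : β ≠ ⊤ := ne_top_of_le_ne_top ENNReal.one_ne_top (h ▸ le_self_add)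
  have hV : discVal M C β = fun y => discRel M C β y + m :=
    funext fun y => (discRel_add_iInf β y).symm
  have key (a : B) : C (x, a) + β * ∫⁻ y, discVal M C β y ∂M.q (x, a)
      = C (x, a) + β * ∫⁻ y, discRel M C β y ∂M.q (x, a) + β * m := by
    rw [hV, lintegral_add_right _ measurable_const, lintegral_const, measure_univ, mul_one, mul_add,
      add_assoc]
  simp_rw [key] at hx
  rw [← ENNReal.iInf_add, ← discRel_add_iInf] at hx
  refine (ENNReal.add_le_add_iff_right (ENNReal.mul_ne_top hβ hm)).1 (hx.trans_eq ?_)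
  rw [add_assoc, ← add_mul, add_comm δ, h, one_mul]

theorem sum_stageCost_le {φ : S → B} (hφ : Measurable φ) (hC : Measurable C) {U : S → ℝ≥0∞}
    (hU : Measurable U) {W : ℝ≥0∞}
    (h : ∀ x, C (x, φ x) + ∫⁻ y, U y ∂M.q (x, φ x) ≤ W + U x) (x : S) (N : ℕ) :
    ∑ t ∈ Finset.range N, stageCost M C (detPolicy φ hφ) x t
      + ∫⁻ h, U h.2 ∂histMeas M (detPolicy φ hφ) x N ≤ N * W + U x := by
  induction N with
  | zero =>
    rw [lintegral_histMeas_zero (g := fun h => U h.2) (hU.comp measurable_snd)]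
    simp
  | succ N ih =>
    have := isProbabilityMeasure_histMeas (M := M) (p := detPolicy φ hφ) x N
    have hφC : Measurable fun h : Hist S B N => C (h.2, φ h.2) :=
      hC.comp (measurable_snd.prodMk (hφ.comp measurable_snd))
    have hstep : stageCost M C (detPolicy φ hφ) x N
        + ∫⁻ h, U h.2 ∂histMeas M (detPolicy φ hφ) x (N + 1)
          ≤ W + ∫⁻ h, U h.2 ∂histMeas M (detPolicy φ hφ) x N := by
      have hq : Measurable fun z : S × B => ∫⁻ y, U y ∂M.q z := hU.lintegral_kernel
      have h₁ (h : Hist S B N) : ∫⁻ a, C (h.2, a) ∂(detPolicy φ hφ).π N h = C (h.2, φ h.2) :=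
        lintegral_dirac' _ (hC.comp measurable_prodMk_left)
      have h₂ (h : Hist S B N) : condNext M (detPolicy φ hφ) (fun h => U h.2) h
          = ∫⁻ y, U y ∂M.q (h.2, φ h.2) :=
        lintegral_dirac' _ (hq.comp measurable_prodMk_left)
      rw [stageCost, lintegral_saMeas hC,
        lintegral_histMeas_succ (g := fun h => U h.2) (hU.comp measurable_snd)]
      simp_rw [h₁, h₂]
      rw [← lintegral_add_left hφC]
      refine (lintegral_mono fun h' : Hist S B N => h h'.2).trans_eq ?_
      rw [lintegral_add_left measurable_const, lintegral_const, measure_univ, mul_one]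
    rw [Finset.sum_range_succ, add_assoc]
    calc _ ≤ ∑ t ∈ Finset.range N, stageCost M C (detPolicy φ hφ) x t
          + (W + ∫⁻ h, U h.2 ∂histMeas M (detPolicy φ hφ) x N) := by gcongr
      _ = W + (∑ t ∈ Finset.range N, stageCost M C (detPolicy φ hφ) x t
          + ∫⁻ h, U h.2 ∂histMeas M (detPolicy φ hφ) x N) := by ring
      _ ≤ W + (N * W + U x) := by gcongr
      _ = _ := by push_cast; ring

end DiscountedCosts

section Tauberian

theorem sum_pow_mul_le_of_sum_le {s : ℕ → ℝ} {b l r : ℝ} (hr₀ : 0 ≤ r) (hr₁ : r ≤ 1)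
    (h : ∀ N, ∑ t ∈ Finset.range N, s t ≤ b + N * l) (N : ℕ) :
    ∑ t ∈ Finset.range N, r ^ t * s t ≤ b + l * ∑ t ∈ Finset.range N, r ^ t := by
  have key : ∑ t ∈ Finset.range N, r ^ t * s t
      + r ^ N * (b + N * l - ∑ t ∈ Finset.range N, s t)
        ≤ b + l * ∑ t ∈ Finset.range N, r ^ t := by
    induction N with
    | zero => simp
    | succ N ih =>
      have h₁ := h (N + 1)
      have h₂ : r ^ (N + 1) ≤ r ^ N := pow_le_pow_of_le_one hr₀ hr₁ N.le_succ
      have h₃ := mul_le_mul_of_nonneg_right h₂ (sub_nonneg.2 h₁)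
      rw [Finset.sum_range_succ] at h₃
      rw [Finset.sum_range_succ, Finset.sum_range_succ, Finset.sum_range_succ]
      push_cast at h₃ ⊢
      linarith
  have := mul_nonneg (pow_nonneg hr₀ N) (sub_nonneg.2 (h N))
  linarith

theorem exists_tsum_pow_mul_le {S : ℕ → ℝ≥0∞} {l : ℝ≥0}
    (h : ∀ᶠ N : ℕ in atTop, ∑ t ∈ Finset.range N, S t ≤ N * l) :
    ∃ b : ℝ≥0, ∀ β δ : ℝ≥0, β + δ = 1 → δ * ∑' t, (β : ℝ≥0∞) ^ t * S t ≤ δ * b + l := by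
  obtain ⟨N₀, hN₀⟩ := eventually_atTop.1 h
  have hfin (t : ℕ) : S t ≠ ⊤ := by
    have h₁ : S t ≤ ∑ t ∈ Finset.range (max (t + 1) N₀), S t :=
      Finset.single_le_sum (f := S) (fun _ _ => zero_le)
        (Finset.mem_range.2 (lt_of_lt_of_le t.lt_succ_self (le_max_left _ _)))
    refine ne_top_of_le_ne_top ?_ (h₁.trans (hN₀ _ (le_max_right _ _)))
    exact ENNReal.mul_ne_top (ENNReal.natCast_ne_top _) ENNReal.coe_ne_top
  lift S to ℕ → ℝ≥0 using hfin
  beta_reduce at h hN₀ ⊢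
  have hbound (N : ℕ) :
      ∑ t ∈ Finset.range N, S t ≤ ∑ t ∈ Finset.range N₀, S t + N * l := by
    rcases le_total N N₀ with hN | hN
    · exact (Finset.sum_le_sum_of_subset (Finset.range_mono hN)).trans le_self_add
    · refine le_trans ?_ le_add_self
      exact_mod_cast hN₀ N hN
  refine ⟨∑ t ∈ Finset.range N₀, S t, fun β δ hβδ => ?_⟩
  rw [ENNReal.tsum_eq_iSup_nat, ENNReal.mul_iSup]
  refine iSup_le fun N => ?_
  have hδ : (β : ℝ) + δ = 1 := by exact_mod_cast hβδ
  have h₁ := sum_pow_mul_le_of_sum_le (s := fun t => (S t : ℝ))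
    (b := ∑ t ∈ Finset.range N₀, (S t : ℝ)) (l := l) β.coe_nonneg
    (by linarith [δ.coe_nonneg]) (fun N => by exact_mod_cast hbound N) N
  have h₂ : (δ : ℝ) * ∑ t ∈ Finset.range N, (β : ℝ) ^ t ≤ 1 := by
    have : (δ : ℝ) = 1 - β := by linarith
    rw [this, mul_neg_geom_sum]
    linarith [pow_nonneg β.coe_nonneg N]
  have h₃ : (δ : ℝ) * ∑ t ∈ Finset.range N, (β : ℝ) ^ t * S t
      ≤ δ * ∑ t ∈ Finset.range N₀, (S t : ℝ) + l := by
    have h₄ := mul_le_mul_of_nonneg_left h₁ δ.coe_nonneg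
    have h₅ := mul_le_mul_of_nonneg_left h₂ l.coe_nonneg
    linarith
  exact_mod_cast h₃

theorem eventually_sum_le_of_limsup_lt {S : ℕ → ℝ≥0∞} {l : ℝ≥0∞}
    (h : limsup (fun N : ℕ => (N : ℝ≥0∞)⁻¹ * ∑ t ∈ Finset.range N, S t) atTop < l) :
    ∀ᶠ N : ℕ in atTop, ∑ t ∈ Finset.range N, S t ≤ N * l := by
  filter_upwards [eventually_lt_of_limsup_lt h, eventually_ge_atTop 1] with N hN hN₁
  exact (ENNReal.inv_mul_le_iff (by positivity) (ENNReal.natCast_ne_top N)).1 hN.le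

instance neBot_nhdsWithin_Ico_one : (𝓝[Ico (0 : ℝ) 1] 1).NeBot := by
  rw [← mem_closure_iff_nhdsWithin_neBot, closure_Ico zero_ne_one]
  exact right_mem_Icc.2 zero_le_one

theorem limsup_tsum_pow_mul_le_limsup_average (S : ℕ → ℝ≥0∞) :
    limsup (fun r : ℝ => ENNReal.ofReal (1 - r) * ∑' t, ENNReal.ofReal r ^ t * S t)
        (𝓝[Ico (0 : ℝ) 1] 1)
      ≤ limsup (fun N : ℕ => (N : ℝ≥0∞)⁻¹ * ∑ t ∈ Finset.range N, S t) atTop := by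
  refine le_of_forall_gt_imp_ge_of_dense fun l hl => ?_
  rcases eq_or_ne l ⊤ with rfl | hl'
  · exact le_top
  lift l to ℝ≥0 using hl'
  obtain ⟨b, hb⟩ := exists_tsum_pow_mul_le (eventually_sum_le_of_limsup_lt hl)
  have hlim : Tendsto (fun r : ℝ => ENNReal.ofReal (1 - r) * b + l) (𝓝[Ico (0 : ℝ) 1] 1)
      (𝓝 (0 * b + l)) := by
    have h₀ : Tendsto (fun r : ℝ => ENNReal.ofReal (1 - r)) (𝓝[Ico (0 : ℝ) 1] 1) (𝓝 0) := by
      have : Continuous fun r : ℝ => ENNReal.ofReal (1 - r) :=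
        ENNReal.continuous_ofReal.comp (by fun_prop)
      simpa using (this.tendsto 1).mono_left nhdsWithin_le_nhds
    exact (ENNReal.Tendsto.mul_const h₀ (Or.inr ENNReal.coe_ne_top)).add_const _
  rw [zero_mul, zero_add] at hlim
  rw [← hlim.limsup_eq]
  refine limsup_le_limsup ?_
  filter_upwards [self_mem_nhdsWithin] with r hr
  exact hb r.toNNReal (1 - r).toNNReal (by
    rw [← Real.toNNReal_add hr.1 (by linarith [hr.2])]
    simp)

theorem tsum_pow_mul_ne_top_of_limsup_average {S : ℕ → ℝ≥0∞}
    (h : limsup (fun N : ℕ => (N : ℝ≥0∞)⁻¹ * ∑ t ∈ Finset.range N, S t) atTop ≠ ⊤)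
    {r : ℝ} (hr : r ∈ Ico (0 : ℝ) 1) : ∑' t, ENNReal.ofReal r ^ t * S t ≠ ⊤ := by
  obtain ⟨l, hl, -⟩ := ENNReal.lt_iff_exists_nnreal_btwn.1 h.lt_top
  obtain ⟨b, hb⟩ := exists_tsum_pow_mul_le (eventually_sum_le_of_limsup_lt hl)
  have := hb r.toNNReal (1 - r).toNNReal (by
    rw [← Real.toNNReal_add hr.1 (by linarith [hr.2])]
    simp)
  intro htop
  change ENNReal.ofReal (1 - r) * ∑' t, ENNReal.ofReal r ^ t * S t ≤ _ at this
  rw [htop, ENNReal.mul_top (by simpa using hr.2), top_le_iff] at this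
  exact (ENNReal.add_ne_top.2 ⟨ENNReal.mul_ne_top ENNReal.coe_ne_top ENNReal.coe_ne_top,
    ENNReal.coe_ne_top⟩) this

end Tauberian

section VanishingDiscount

variable {S B : Type*} [MetricSpace S] [MetricSpace B]

theorem lowerSemicontinuous_of_infCompact {C : S × B → ℝ≥0∞}
    (hC : ∀ K, IsCompact K → ∀ r < ⊤, IsCompact {z : S × B | z.1 ∈ K ∧ C z ≤ r}) :
    LowerSemicontinuous C := by
  rw [lowerSemicontinuous_iff_isClosed_preimage]
  intro r
  rcases eq_or_ne r ⊤ with rfl | hr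
  · simp
  refine IsSeqClosed.isClosed fun z z₀ hz hlim => ?_
  have hlim₁ : Tendsto (fun k => (z k).1) atTop (𝓝 z₀.1) := (continuous_fst.tendsto z₀).comp hlim
  have hmem : z₀ ∈ {z' : S × B | z'.1 ∈ insert z₀.1 (range fun k => (z k).1) ∧ C z' ≤ r} :=
    (hC _ hlim₁.isCompact_insert_range r hr.lt_top).isClosed.mem_of_tendsto hlim
      (Eventually.of_forall fun k => ⟨mem_insert_of_mem _ (mem_range_self k), hz k⟩)
  exact hmem.2

theorem LowerSemicontinuous.le_of_tendsto_seq {P : Type*} [TopologicalSpace P] {f : P → ℝ≥0∞}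
    (hf : LowerSemicontinuous f) {z : ℕ → P} {z₀ : P} (hz : Tendsto z atTop (𝓝 z₀)) {r : ℝ≥0∞}
    (h : ∀ᶠ k in atTop, f (z k) ≤ r) : f z₀ ≤ r := by
  by_contra! hr
  obtain ⟨k, hk₁, hk₂⟩ := ((hz.eventually (hf z₀ r hr)).and h).exists
  exact hk₁.not_ge hk₂

theorem lowerSemicontinuous_liminf_prod (U : ℕ → S → ℝ≥0∞) :
    LowerSemicontinuous fun x =>
      liminf (fun p : ℕ × S => U p.1 p.2) ((atTop : Filter ℕ) ×ˢ 𝓝 x) := by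
  simp_rw [← iSup_tailEnvelope U]
  exact lowerSemicontinuous_iSup fun n => lowerSemicontinuous_tailEnvelope U n

variable [MeasurableSpace S] [BorelSpace S]

theorem exists_lintegral_liminf_le {C : S × B → ℝ≥0∞}
    (hC : ∀ K, IsCompact K → ∀ r < ⊤, IsCompact {z : S × B | z.1 ∈ K ∧ C z ≤ r})
    {μ : S × B → Measure S} (hμ : ∀ G, IsOpen G → LowerSemicontinuous fun z => μ z G)
    {β : ℕ → ℝ≥0∞} (hβ : Monotone β) (hβ₁ : Tendsto β atTop (𝓝 1))
    {U : ℕ → S → ℝ≥0∞} {w : ℕ → ℝ≥0∞}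
    (h : ∀ n x, ⨅ a, (C (x, a) + β n * ∫⁻ y, U n y ∂μ (x, a)) ≤ U n x + w n)
    {x : S} {r : ℝ≥0∞}
    (hr : limsup w atTop
      + liminf (fun p : ℕ × S => U p.1 p.2) ((atTop : Filter ℕ) ×ˢ 𝓝 x) < r) :
    ∃ a, C (x, a) + ∫⁻ y, liminf (fun p : ℕ × S => U p.1 p.2) ((atTop : Filter ℕ) ×ˢ 𝓝 y)
      ∂μ (x, a) ≤ r := by
  obtain ⟨r', hr', hr'r⟩ := exists_between hr
  have hr'_top : r' < ⊤ := hr'r.trans_le le_top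
  obtain ⟨ε, hε, hεr⟩ := ENNReal.lt_iff_exists_add_pos_lt.1 hr'
  set W := limsup w atTop
  set v := liminf (fun p : ℕ × S => U p.1 p.2) ((atTop : Filter ℕ) ×ˢ 𝓝 x)
  have hWv : W + v ≠ ⊤ := (hr'.trans hr'_top).ne
  have hε₂ : (ε : ℝ≥0∞) / 2 ≠ 0 := (ENNReal.half_pos (by exact_mod_cast hε.ne')).ne'
  have hw : ∀ᶠ n in atTop, w n < W + ε / 2 :=
    eventually_lt_of_limsup_lt (ENNReal.lt_add_right (ENNReal.add_ne_top.1 hWv).1 hε₂)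
  have hU : ∃ᶠ p : ℕ × S in atTop ×ˢ 𝓝 x, U p.1 p.2 < v + ε / 2 :=
    frequently_lt_of_liminf_lt (h := ENNReal.lt_add_right (ENNReal.add_ne_top.1 hWv).2 hε₂)
  have hfreq : ∃ᶠ p : ℕ × S in atTop ×ˢ 𝓝 x,
      ∃ a, C (p.2, a) + β p.1 * ∫⁻ y, U p.1 y ∂μ (p.2, a) < r' := by
    refine (hU.and_eventually (hw.prod_inl (𝓝 x))).mono fun p hp => iInf_lt_iff.1 ?_
    refine (h p.1 p.2).trans_lt (lt_of_le_of_lt (add_le_add hp.1.le hp.2.le) ?_)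
    calc v + ε / 2 + (W + ε / 2) = W + v + (ε / 2 + ε / 2) := by ring
      _ < r' := by rwa [ENNReal.add_halves]
  obtain ⟨p, hp, hpa⟩ := exists_seq_forall_of_frequently hfreq
  choose b hb using hpa
  have hp₁ : Tendsto (fun k => (p k).1) atTop atTop := tendsto_fst.comp hp
  have hp₂ : Tendsto (fun k => (p k).2) atTop (𝓝 x) := tendsto_snd.comp hp
  obtain ⟨z, -, ψ, hψ, hz⟩ := (hC _ hp₂.isCompact_insert_range r' hr'_top).tendsto_subseq
    (x := fun k => ((p k).2, b k)) fun k => ⟨Or.inr ⟨k, rfl⟩, le_self_add.trans (hb k).le⟩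
  have hzx : z.1 = x := tendsto_nhds_unique ((continuous_fst.tendsto z).comp hz)
    (hp₂.comp hψ.tendsto_atTop)
  have hle (m n : ℕ) : C z + β m * ∫⁻ y, tailEnvelope U n y ∂μ z ≤ r' := by
    rcases eq_or_ne (β m) ⊤ with hm | hm
    · have h₁ : β m ≤ 1 := hβ.ge_of_tendsto hβ₁ m
      rw [hm] at h₁
      exact absurd h₁ (by simp)
    have hlsc : LowerSemicontinuous fun z => C z + β m * ∫⁻ y, tailEnvelope U n y ∂μ z :=
      (lowerSemicontinuous_of_infCompact hC).add
        ((ENNReal.continuous_const_mul hm).comp_lowerSemicontinuous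
          (lowerSemicontinuous_lintegral_of_isOpen hμ (lowerSemicontinuous_tailEnvelope U n))
          fun _ _ h => mul_le_mul_right h _)
    refine hlsc.le_of_tendsto_seq hz ?_
    filter_upwards [(hp₁.comp hψ.tendsto_atTop).eventually_ge_atTop (max m n)] with k hk
    change max m n ≤ (p (ψ k)).1 at hk
    change C ((p (ψ k)).2, b (ψ k))
      + β m * ∫⁻ y, tailEnvelope U n y ∂μ ((p (ψ k)).2, b (ψ k)) ≤ r'
    refine le_trans ?_ (hb (ψ k)).le
    gcongr
    · exact hβ ((le_max_left m n).trans hk)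
    · exact tailEnvelope_le U ((le_max_right m n).trans hk) _
  refine ⟨z.2, le_trans ?_ hr'r.le⟩
  rw [← hzx]
  simp_rw [← iSup_tailEnvelope U]
  rw [lintegral_iSup (fun n => (lowerSemicontinuous_tailEnvelope U n).measurable)
    (monotone_tailEnvelope U), ENNReal.add_iSup]
  refine iSup_le fun n => ?_
  have hlim : Tendsto (fun m => C z + β m * ∫⁻ y, tailEnvelope U n y ∂μ z) atTop
      (𝓝 (C z + 1 * ∫⁻ y, tailEnvelope U n y ∂μ z)) :=
    (ENNReal.Tendsto.mul_const hβ₁ (Or.inl one_ne_zero)).const_add _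
  rw [one_mul] at hlim
  exact le_of_tendsto' hlim fun m => hle m n

theorem isCompact_sublevel_add_lintegral {C : S × B → ℝ≥0∞}
    (hC : ∀ K, IsCompact K → ∀ r < ⊤, IsCompact {z : S × B | z.1 ∈ K ∧ C z ≤ r})
    {μ : S × B → Measure S} (hμ : ∀ G, IsOpen G → LowerSemicontinuous fun z => μ z G)
    {V : S → ℝ≥0∞} (hV : LowerSemicontinuous V) {K : Set S} (hK : IsCompact K) {r : ℝ≥0∞}
    (hr : r < ⊤) : IsCompact {z : S × B | z.1 ∈ K ∧ C z + ∫⁻ y, V y ∂μ z ≤ r} := by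
  have hlsc : LowerSemicontinuous fun z => C z + ∫⁻ y, V y ∂μ z :=
    (lowerSemicontinuous_of_infCompact hC).add (lowerSemicontinuous_lintegral_of_isOpen hμ hV)
  refine (hC K hK r hr).of_isClosed_subset ?_ fun z hz => ⟨hz.1, le_self_add.trans hz.2⟩
  exact (hK.isClosed.preimage continuous_fst).inter
    (lowerSemicontinuous_iff_isClosed_preimage.1 hlsc r)

end VanishingDiscount

section ExtendedReals

theorem eToENN_eq_toENNReal (x : EReal) : eToENN x = x.toENNReal := rfl

theorem eToENN_coe_add (s : ℝ≥0∞) (k : ℝ) :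
    eToENN (s + k) + ENNReal.ofReal (-k) = s + ENNReal.ofReal k + eToENN (-(s + k)) := by
  simp only [eToENN_eq_toENNReal]
  induction s with
  | top => simp
  | coe s =>
    have h : ((s : ℝ≥0∞) : EReal) = ((s : ℝ) : EReal) := rfl
    have hs : (s : ℝ≥0∞) = ENNReal.ofReal s := (ENNReal.ofReal_coe_nnreal).symm
    rw [h, ← EReal.coe_add, ← EReal.coe_neg, EReal.real_coe_toENNReal, EReal.real_coe_toENNReal, hs]
    have key (x : ℝ) : ENNReal.ofReal x = ENNReal.ofReal (max x 0) := by simp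
    rw [key (s + k), key (-k), key k, key (-(s + k)),
      ← ENNReal.ofReal_add (by positivity) (by positivity),
      ← ENNReal.ofReal_add (by positivity) (by positivity),
      ← ENNReal.ofReal_add (by positivity) (by positivity)]
    congr 1
    have h₁ := max_zero_sub_max_neg_zero_eq_self ((s : ℝ) + k)
    have h₂ := max_zero_sub_max_neg_zero_eq_self k
    linarith

theorem eToENN_neg_coe_add_le (s : ℝ≥0∞) (k : ℝ) :
    eToENN (-(s + k)) ≤ ENNReal.ofReal (-k) := by
  rw [eToENN_eq_toENNReal, ← EReal.real_coe_toENNReal, EReal.coe_neg]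
  refine EReal.toENNReal_le_toENNReal (EReal.neg_le_neg_iff.2 ?_)
  exact le_add_of_nonneg_left (EReal.coe_ennreal_nonneg s)

theorem coe_sub_coe_eq_coe_add {P Q f b d : ℝ≥0∞} (h : P + b = f + d + Q) (hb : b ≠ ⊤)
    (hd : d ≠ ⊤) (hQ : Q ≠ ⊤) :
    (P : EReal) - Q = f + ((d.toReal - b.toReal : ℝ) : EReal) := by
  lift b to ℝ≥0 using hb
  lift d to ℝ≥0 using hd
  lift Q to ℝ≥0 using hQ
  induction f with
  | top =>
    have hP : P = ⊤ := by
      by_contra hP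
      exact ENNReal.add_ne_top.2 ⟨hP, ENNReal.coe_ne_top⟩ (by rw [h]; simp)
    rw [hP]
    simp only [EReal.coe_ennreal_top, EReal.top_add_coe]
    exact EReal.top_sub_coe Q
  | coe f =>
    have hP : P ≠ ⊤ := by
      intro hP
      rw [hP] at h
      exact absurd h.symm (by simp)
    lift P to ℝ≥0 using hP
    have h' : (P : ℝ) + b = f + d + Q := by exact_mod_cast h
    change ((P : ℝ) : EReal) - ((Q : ℝ) : EReal) = ((f : ℝ) : EReal) + _
    rw [← EReal.coe_sub, ← EReal.coe_add]
    congr 1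
    simp only [ENNReal.coe_toReal]
    linarith

theorem toReal_ofReal_sub_toReal_ofReal_neg (k : ℝ) :
    (ENNReal.ofReal k).toReal - (ENNReal.ofReal (-k)).toReal = k := by
  rw [ENNReal.toReal_ofReal', ENNReal.toReal_ofReal', max_zero_sub_max_neg_zero_eq_self]

theorem eInt_coe {Y : Type*} [MeasurableSpace Y] (μ : Measure Y) (f : Y → ℝ≥0∞) :
    eInt μ (fun y => (f y : EReal)) = ((∫⁻ y, f y ∂μ : ℝ≥0∞) : EReal) := by
  have h (y : Y) : eToENN (-(f y : EReal)) = 0 :=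
    EReal.toENNReal_of_nonpos (by simpa using EReal.coe_ennreal_nonneg (f y))
  simp_rw [eInt, h, lintegral_zero, eToENN_eq_toENNReal, EReal.toENNReal_coe]
  simp

theorem eInt_coe_add_const {Y : Type*} [MeasurableSpace Y] (μ : Measure Y)
    [IsProbabilityMeasure μ] {f : Y → ℝ≥0∞} (hf : Measurable f) (k : ℝ) :
    eInt μ (fun y => (f y : EReal) + k) = ((∫⁻ y, f y ∂μ : ℝ≥0∞) : EReal) + k := by
  have h := lintegral_congr (μ := μ) fun y => eToENN_coe_add (f y) k
  rw [lintegral_add_right _ measurable_const, lintegral_add_left (f := fun y => f y + ENNReal.ofReal k) (hf.add measurable_const),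
    lintegral_add_left hf] at h
  simp only [lintegral_const, measure_univ, mul_one] at h
  have hQ := lintegral_mono (μ := μ) fun y => eToENN_neg_coe_add_le (f y) k
  simp only [lintegral_const, measure_univ, mul_one] at hQ
  rw [eInt, coe_sub_coe_eq_coe_add h ENNReal.ofReal_ne_top ENNReal.ofReal_ne_top
    (ne_top_of_le_ne_top ENNReal.ofReal_ne_top hQ), toReal_ofReal_sub_toReal_ofReal_neg]

theorem coe_mul_coe_add {r : ℝ} (hr : 0 ≤ r) (s : ℝ≥0∞) (k : ℝ) :
    (r : EReal) * (s + k) = ((ENNReal.ofReal r * s : ℝ≥0∞) : EReal) + ((r * k : ℝ) : EReal) := by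
  induction s with
  | top =>
    rcases hr.eq_or_lt with rfl | hr
    · simp
    · rw [EReal.coe_ennreal_top, EReal.top_add_coe, EReal.coe_mul_top_of_pos hr,
        ENNReal.mul_top (by simpa using hr), EReal.coe_ennreal_top, EReal.top_add_coe]
  | coe s =>
    lift r to ℝ≥0 using hr
    rw [ENNReal.ofReal_coe_nnreal, ← ENNReal.coe_mul]
    change ((r : ℝ) : EReal) * (((s : ℝ) : EReal) + k)
      = (((r * s : ℝ≥0) : ℝ) : EReal) + ((r * k : ℝ) : EReal)
    rw [← EReal.coe_add, ← EReal.coe_mul, ← EReal.coe_add]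
    rw [NNReal.coe_mul, mul_add]

theorem eSum_pow_mul_coe_add {r : ℝ} (hr : r ∈ Ico (0 : ℝ) 1) (f : ℕ → ℝ≥0∞) (k : ℝ) :
    eSum (fun t => ((r ^ t : ℝ) : EReal) * (f t + k))
      = ((∑' t, ENNReal.ofReal r ^ t * f t : ℝ≥0∞) : EReal) + (((1 - r)⁻¹ * k : ℝ) : EReal) := by
  have hpow (t : ℕ) : 0 ≤ r ^ t := pow_nonneg hr.1 t
  have hgeom (b : ℝ) : ∑' t, ENNReal.ofReal (r ^ t * b) = ENNReal.ofReal ((1 - r)⁻¹ * b) := by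
    simp_rw [ENNReal.ofReal_mul (hpow _)]
    rw [ENNReal.tsum_mul_right, ← ENNReal.ofReal_tsum_of_nonneg hpow
      (summable_geometric_of_lt_one hr.1 hr.2), tsum_geometric_of_lt_one hr.1 hr.2,
      ENNReal.ofReal_mul (inv_nonneg.2 (by linarith [hr.2]))]
  simp_rw [coe_mul_coe_add (hpow _), ENNReal.ofReal_pow hr.1]
  have h := tsum_congr (L := .unconditional ℕ) fun t => eToENN_coe_add (ENNReal.ofReal r ^ t * f t) (r ^ t * k)
  have hQ := ENNReal.tsum_le_tsum
    fun t => eToENN_neg_coe_add_le (ENNReal.ofReal r ^ t * f t) (r ^ t * k)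
  simp_rw [← mul_neg] at h hQ
  rw [ENNReal.tsum_add, ENNReal.tsum_add, ENNReal.tsum_add, hgeom, hgeom] at h
  rw [hgeom] at hQ
  rw [eSum, coe_sub_coe_eq_coe_add h ENNReal.ofReal_ne_top ENNReal.ofReal_ne_top
    (ne_top_of_le_ne_top ENNReal.ofReal_ne_top hQ), mul_neg, toReal_ofReal_sub_toReal_ofReal_neg]

theorem continuous_coe_add_const (k : ℝ) : Continuous fun s : ℝ≥0∞ => (s : EReal) + k := by
  refine continuous_iff_continuousAt.2 fun s => ?_
  exact (EReal.continuousAt_add (p := ((s : EReal), (k : EReal))) (Or.inr (EReal.coe_ne_bot k))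
    (Or.inr (EReal.coe_ne_top k))).comp (f := fun s : ℝ≥0∞ => ((s : EReal), (k : EReal)))
      (continuous_coe_ennreal_ereal.continuousAt.prodMk continuousAt_const)

theorem monotone_coe_add_const (k : ℝ) : Monotone fun s : ℝ≥0∞ => (s : EReal) + k :=
  fun _ _ h => add_le_add_left (EReal.coe_ennreal_le_coe_ennreal_iff.2 h) _

theorem coe_add_const_injective (k : ℝ) :
    Function.Injective fun s : ℝ≥0∞ => (s : EReal) + k := fun s t h => by
  have h' := congrArg (fun z : EReal => z - k) h
  simpa [EReal.add_sub_cancel_right] using h'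

theorem iInf_coe_add_const {ι : Type*} (f : ι → ℝ≥0∞) (k : ℝ) :
    ⨅ i, ((f i : EReal) + k) = ((⨅ i, f i : ℝ≥0∞) : EReal) + k :=
  (Monotone.map_iInf_of_continuousAt (continuous_coe_add_const k).continuousAt
    (monotone_coe_add_const k) (by simp)).symm

theorem limsup_coe_add_const {ι : Type*} {l : Filter ι} [l.NeBot] (f : ι → ℝ≥0∞) (k : ℝ) :
    limsup (fun i => (f i : EReal) + k) l = ((limsup f l : ℝ≥0∞) : EReal) + k :=
  ((monotone_coe_add_const k).map_limsup_of_continuousAt f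
    (continuous_coe_add_const k).continuousAt).symm

theorem liminf_coe {ι : Type*} {l : Filter ι} [l.NeBot] (f : ι → ℝ≥0∞) :
    liminf (fun i => (f i : EReal)) l = ((liminf f l : ℝ≥0∞) : EReal) :=
  (EReal.coe_ennreal_strictMono.monotone.map_liminf_of_continuousAt f
    continuous_coe_ennreal_ereal.continuousAt).symm

end ExtendedReals

section ShiftedCost

variable {S B : Type*} [MeasurableSpace S] [MeasurableSpace B]

/-- The cost `c - k` as a nonnegative function, for a lower bound `k` of `c`. -/
def shiftedCost (M : MDP S B) (k : ℝ) (z : S × B) : ℝ≥0∞ := eToENN (M.c z.1 z.2 - k)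

theorem coe_shiftedCost_add {M : MDP S B} {k : ℝ} (hk : ∀ x a, (k : EReal) ≤ M.c x a)
    (z : S × B) : (shiftedCost M k z : EReal) + k = M.c z.1 z.2 := by
  rw [shiftedCost, eToENN_eq_toENNReal, EReal.coe_toENNReal, EReal.sub_add_cancel]
  rw [EReal.sub_nonneg (Or.inr (EReal.coe_ne_top k)) (Or.inr (EReal.coe_ne_bot k))]
  exact hk _ _

theorem measurable_shiftedCost (M : MDP S B) (k : ℝ) : Measurable (shiftedCost M k) := by
  have h : Continuous fun x : EReal => x - k := by
    refine continuous_iff_continuousAt.2 fun x => ?_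
    exact (EReal.continuousAt_add (p := (x, -(k : EReal))) (Or.inr (by simp))
      (Or.inr (by simp))).comp (f := fun x : EReal => (x, -(k : EReal)))
        (continuousAt_id.prodMk continuousAt_const)
  exact measurable_ereal_toENNReal.comp (h.measurable.comp M.c_meas)

/-- The long-run average of a nonnegative cost `C`. -/
def averageCost (M : MDP S B) (C : S × B → ℝ≥0∞) (p : Policy S B) (x : S) : ℝ≥0∞ :=
  limsup (fun N : ℕ => (N : ℝ≥0∞)⁻¹ * ∑ t ∈ Finset.range N, stageCost M C p x t) atTop

variable {M : MDP S B} {C : S × B → ℝ≥0∞} {k : ℝ}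

theorem expCost_eq_coe_add (hC : Measurable C) (hk : ∀ z, (C z : EReal) + k = M.c z.1 z.2)
    (p : Policy S B) (x : S) (t : ℕ) : expCost M p x t = stageCost M C p x t + k := by
  have := isProbabilityMeasure_saMeas (M := M) (p := p) x t
  simp_rw [expCost, ← hk]
  exact eInt_coe_add_const _ hC k

theorem vDisc_eq_coe_add (hC : Measurable C) (hk : ∀ z, (C z : EReal) + k = M.c z.1 z.2)
    {r : ℝ} (hr : r ∈ Ico (0 : ℝ) 1) (p : Policy S B) (x : S) :
    vDisc M r p x = discCost M C (ENNReal.ofReal r) p x + (((1 - r)⁻¹ * k : ℝ) : EReal) := by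
  simp_rw [vDisc, expCost_eq_coe_add hC hk]
  exact eSum_pow_mul_coe_add hr _ k

theorem vDiscOpt_eq_coe_add (hC : Measurable C) (hk : ∀ z, (C z : EReal) + k = M.c z.1 z.2)
    {r : ℝ} (hr : r ∈ Ico (0 : ℝ) 1) (x : S) :
    vDiscOpt M r x = discVal M C (ENNReal.ofReal r) x + (((1 - r)⁻¹ * k : ℝ) : EReal) := by
  simp_rw [vDiscOpt, vDisc_eq_coe_add hC hk hr]
  exact iInf_coe_add_const _ _

theorem mDisc_eq_coe_add (hC : Measurable C) (hk : ∀ z, (C z : EReal) + k = M.c z.1 z.2)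
    {r : ℝ} (hr : r ∈ Ico (0 : ℝ) 1) :
    mDisc M r = ((⨅ x, discVal M C (ENNReal.ofReal r) x : ℝ≥0∞) : EReal)
      + (((1 - r)⁻¹ * k : ℝ) : EReal) := by
  simp_rw [mDisc, vDiscOpt_eq_coe_add hC hk hr]
  exact iInf_coe_add_const _ _

theorem uDisc_eq_coe (hC : Measurable C) (hk : ∀ z, (C z : EReal) + k = M.c z.1 z.2)
    {r : ℝ} (hr : r ∈ Ico (0 : ℝ) 1) (hm : ⨅ x, discVal M C (ENNReal.ofReal r) x ≠ ⊤) (x : S) :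
    uDisc M r x = discRel M C (ENNReal.ofReal r) x := by
  rw [uDisc, vDiscOpt_eq_coe_add hC hk hr, mDisc_eq_coe_add hC hk hr, ← discRel_add_iInf]
  set m := ⨅ x, discVal M C (ENNReal.ofReal r) x
  lift m to ℝ≥0 using hm with m'
  rw [EReal.coe_ennreal_add, add_assoc]
  change _ + (((m' : ℝ) : EReal) + _) - (((m' : ℝ) : EReal) + _) = _
  rw [← EReal.coe_add, EReal.add_sub_cancel_right]

theorem one_sub_mul_coe_add {r : ℝ} (hr : r ∈ Ico (0 : ℝ) 1) (s : ℝ≥0∞) (k : ℝ) :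
    ((1 - r : ℝ) : EReal) * (s + (((1 - r)⁻¹ * k : ℝ) : EReal))
      = ((ENNReal.ofReal (1 - r) * s : ℝ≥0∞) : EReal) + k := by
  rw [coe_mul_coe_add (by linarith [hr.2]), mul_inv_cancel_left₀ (by linarith [hr.2])]

theorem vFin_eq_coe_add (hC : Measurable C) (hk : ∀ z, (C z : EReal) + k = M.c z.1 z.2)
    (p : Policy S B) (x : S) (N : ℕ) :
    vFin M N p x = ((∑ t ∈ Finset.range N, stageCost M C p x t : ℝ≥0∞) : EReal)
      + ((N * k : ℝ) : EReal) := by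
  induction N with
  | zero => simp [vFin]
  | succ N ih =>
    rw [vFin] at ih ⊢
    rw [Finset.sum_range_succ, ih, Finset.sum_range_succ, expCost_eq_coe_add hC hk,
      EReal.coe_ennreal_add, add_add_add_comm, ← EReal.coe_add]
    congr 2
    push_cast
    ring

theorem avgCost_eq_coe_add (hC : Measurable C) (hk : ∀ z, (C z : EReal) + k = M.c z.1 z.2)
    (p : Policy S B) (x : S) : avgCost M p x = averageCost M C p x + k := by
  rw [avgCost, averageCost, ← limsup_coe_add_const]
  refine limsup_congr ?_
  filter_upwards [eventually_ge_atTop 1] with N hN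
  have hN' : (0 : ℝ) < N := by exact_mod_cast hN
  rw [vFin_eq_coe_add hC hk, coe_mul_coe_add (inv_nonneg.2 hN'.le), inv_mul_cancel_left₀ hN'.ne',
    ENNReal.ofReal_inv_of_pos hN', ENNReal.ofReal_natCast]

theorem avgOpt_eq_coe_add (hC : Measurable C) (hk : ∀ z, (C z : EReal) + k = M.c z.1 z.2)
    (x : S) : avgOpt M x = ((⨅ p, averageCost M C p x : ℝ≥0∞) : EReal) + k := by
  simp_rw [avgOpt, avgCost_eq_coe_add hC hk]
  exact iInf_coe_add_const _ _

theorem wStar_eq_coe_add (hC : Measurable C) (hk : ∀ z, (C z : EReal) + k = M.c z.1 z.2) :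
    wStar M = ((⨅ x, ⨅ p, averageCost M C p x : ℝ≥0∞) : EReal) + k := by
  simp_rw [wStar, avgOpt_eq_coe_add hC hk]
  exact iInf_coe_add_const _ _

theorem limsup_vDiscOpt_eq_coe_add (hC : Measurable C)
    (hk : ∀ z, (C z : EReal) + k = M.c z.1 z.2) (x : S) :
    limsup (fun r : ℝ => ((1 - r : ℝ) : EReal) * vDiscOpt M r x) (𝓝[Ico (0 : ℝ) 1] 1)
      = ((limsup (fun r : ℝ => ENNReal.ofReal (1 - r) * discVal M C (ENNReal.ofReal r) x)
          (𝓝[Ico (0 : ℝ) 1] 1) : ℝ≥0∞) : EReal) + k := by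
  rw [← limsup_coe_add_const]
  refine limsup_congr ?_
  filter_upwards [self_mem_nhdsWithin] with r hr
  rw [vDiscOpt_eq_coe_add hC hk hr, one_sub_mul_coe_add hr]

theorem wBar_eq_coe_add (hC : Measurable C) (hk : ∀ z, (C z : EReal) + k = M.c z.1 z.2) :
    wBar M = ((limsup (fun r : ℝ => ENNReal.ofReal (1 - r)
      * ⨅ x, discVal M C (ENNReal.ofReal r) x) (𝓝[Ico (0 : ℝ) 1] 1) : ℝ≥0∞) : EReal) + k := by
  rw [wBar, ← limsup_coe_add_const]
  refine limsup_congr ?_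
  filter_upwards [self_mem_nhdsWithin] with r hr
  rw [mDisc_eq_coe_add hC hk hr, one_sub_mul_coe_add hr]

theorem wBarSeq_eq_coe_add (hC : Measurable C) (hk : ∀ z, (C z : EReal) + k = M.c z.1 z.2)
    {a : ℕ → ℝ} (ha : ∀ n, a n ∈ Ico (0 : ℝ) 1) :
    wBarSeq M a = ((limsup (fun n => ENNReal.ofReal (1 - a n)
      * ⨅ x, discVal M C (ENNReal.ofReal (a n)) x) atTop : ℝ≥0∞) : EReal) + k := by
  rw [wBarSeq, ← limsup_coe_add_const]
  refine limsup_congr (Eventually.of_forall fun n => ?_)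
  rw [mDisc_eq_coe_add hC hk (ha n), one_sub_mul_coe_add (ha n)]

theorem limsup_seq_vDiscOpt_eq_coe_add (hC : Measurable C)
    (hk : ∀ z, (C z : EReal) + k = M.c z.1 z.2) {a : ℕ → ℝ} (ha : ∀ n, a n ∈ Ico (0 : ℝ) 1)
    (x : S) :
    limsup (fun n => ((1 - a n : ℝ) : EReal) * vDiscOpt M (a n) x) atTop
      = ((limsup (fun n => ENNReal.ofReal (1 - a n) * discVal M C (ENNReal.ofReal (a n)) x)
          atTop : ℝ≥0∞) : EReal) + k := by
  rw [← limsup_coe_add_const]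
  refine limsup_congr (Eventually.of_forall fun n => ?_)
  rw [vDiscOpt_eq_coe_add hC hk (ha n), one_sub_mul_coe_add (ha n)]

theorem limsup_discVal_le_averageCost (p : Policy S B) (x : S) :
    limsup (fun r : ℝ => ENNReal.ofReal (1 - r) * discVal M C (ENNReal.ofReal r) x)
      (𝓝[Ico (0 : ℝ) 1] 1) ≤ averageCost M C p x := by
  refine le_trans (limsup_le_limsup (Eventually.of_forall fun r => ?_))
    (limsup_tsum_pow_mul_le_limsup_average _)
  exact mul_le_mul_right (iInf_le _ p) _

theorem limsup_iInf_discVal_le :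
    limsup (fun r : ℝ => ENNReal.ofReal (1 - r) * ⨅ x, discVal M C (ENNReal.ofReal r) x)
      (𝓝[Ico (0 : ℝ) 1] 1) ≤ ⨅ x, ⨅ p, averageCost M C p x := by
  refine le_iInf₂ fun x p => le_trans (limsup_le_limsup (Eventually.of_forall fun r => ?_))
    (limsup_discVal_le_averageCost p x)
  exact mul_le_mul_right (iInf_le _ x) _

theorem iInf_discVal_ne_top (h : ⨅ x, ⨅ p, averageCost M C p x ≠ ⊤) {r : ℝ}
    (hr : r ∈ Ico (0 : ℝ) 1) : ⨅ x, discVal M C (ENNReal.ofReal r) x ≠ ⊤ := by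
  obtain ⟨x, hx⟩ := iInf_lt_iff.1 h.lt_top
  obtain ⟨p, hp⟩ := iInf_lt_iff.1 hx
  exact ne_top_of_le_ne_top (tsum_pow_mul_ne_top_of_limsup_average hp.ne hr)
    ((iInf_le _ x).trans (iInf_le _ p))

theorem averageCost_le_of_sum_le {p : Policy S B} {x : S} {w v : ℝ≥0∞} (hv : v ≠ ⊤)
    (h : ∀ N : ℕ, ∑ t ∈ Finset.range N, stageCost M C p x t ≤ N * w + v) :
    averageCost M C p x ≤ w := by
  have hlim : Tendsto (fun N : ℕ => w + (N : ℝ≥0∞)⁻¹ * v) atTop (𝓝 (w + 0 * v)) :=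
    (ENNReal.Tendsto.mul_const ENNReal.tendsto_inv_nat_nhds_zero (Or.inr hv)).const_add _
  rw [zero_mul, add_zero] at hlim
  rw [averageCost, ← hlim.limsup_eq]
  refine limsup_le_limsup ?_
  filter_upwards [eventually_ge_atTop 1] with N hN
  refine (mul_le_mul_right (h N) _).trans_eq ?_
  rw [mul_add, ← mul_assoc, ENNReal.inv_mul_cancel (by positivity) (ENNReal.natCast_ne_top N),
    one_mul]

end ShiftedCost

section AverageOptimality

set_option linter.unusedSectionVars false in
theorem AssumptionWi.isCompact_sublevel {M : MDP X A} (hM : AssumptionWi M) {k : ℝ}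
    {C : X × A → ℝ≥0∞} (hk : ∀ z, (C z : EReal) + k = M.c z.1 z.2) {K : Set X} (hK : IsCompact K)
    {r : ℝ≥0∞} (hr : r < ⊤) : IsCompact {z : X × A | z.1 ∈ K ∧ C z ≤ r} := by
  rcases K.eq_empty_or_nonempty with rfl | hne
  · simp
  lift r to ℝ≥0 using hr.ne
  convert hM K hne hK (r + k) using 1
  ext z
  refine and_congr_right fun _ => ?_
  rw [← hk, EReal.coe_add]
  exact ((monotone_coe_add_const k).strictMono_of_injective
    (coe_add_const_injective k)).le_iff_le.symm

theorem liminf_prod_nhds_le {P : Type*} [TopologicalSpace P] (f : ℕ → P → ℝ≥0∞) (x : P) :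
    liminf (fun p : ℕ × P => f p.1 p.2) ((atTop : Filter ℕ) ×ˢ 𝓝 x)
      ≤ liminf (fun n => f n x) atTop := by
  have h : Tendsto (fun n : ℕ => (n, x)) atTop ((atTop : Filter ℕ) ×ˢ 𝓝 x) :=
    tendsto_id.prodMk tendsto_const_nhds
  exact liminf_le_liminf_of_le h

theorem limsup_comp_le_of_tendsto {f : ℝ → ℝ≥0∞} {a : ℕ → ℝ}
    (ha : ∀ n, a n ∈ Ico (0 : ℝ) 1) (hlim : Tendsto a atTop (𝓝 1)) :
    limsup (fun n => f (a n)) atTop ≤ limsup f (𝓝[Ico (0 : ℝ) 1] 1) :=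
  limsup_le_limsup_of_le
    (tendsto_nhdsWithin_iff.2 ⟨hlim, Eventually.of_forall ha⟩ : Tendsto a atTop _)

set_option linter.unusedSectionVars false in
theorem exists_measurable_add_lintegral_liminf_le {M : MDP X A} {C : X × A → ℝ≥0∞}
    (hC : ∀ K, IsCompact K → ∀ r < ⊤, IsCompact {z : X × A | z.1 ∈ K ∧ C z ≤ r})
    (hCm : Measurable C) (hW2 : AssumptionWii M) {a : ℕ → ℝ} (ha : ∀ n, a n ∈ Ico (0 : ℝ) 1)
    (hamono : Monotone a) (hatend : Tendsto a atTop (𝓝 1))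
    (hm : ∀ n, ⨅ x, discVal M C (ENNReal.ofReal (a n)) x ≠ ⊤)
    (hW : limsup (fun n => ENNReal.ofReal (1 - a n)
      * ⨅ x, discVal M C (ENNReal.ofReal (a n)) x) atTop ≠ ⊤)
    (hU : ∀ x, liminf (fun p : ℕ × X => discRel M C (ENNReal.ofReal (a p.1)) p.2)
      ((atTop : Filter ℕ) ×ˢ 𝓝 x) ≠ ⊤) :
    ∃ φ : X → A, Measurable φ ∧ ∀ x, C (x, φ x)
      + ∫⁻ y, liminf (fun p : ℕ × X => discRel M C (ENNReal.ofReal (a p.1)) p.2)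
          ((atTop : Filter ℕ) ×ˢ 𝓝 y) ∂M.q (x, φ x)
      ≤ limsup (fun n => ENNReal.ofReal (1 - a n)
          * ⨅ x, discVal M C (ENNReal.ofReal (a n)) x) atTop
        + liminf (fun p : ℕ × X => discRel M C (ENNReal.ofReal (a p.1)) p.2)
          ((atTop : Filter ℕ) ×ˢ 𝓝 x) := by
  have hμ (G : Set X) (hG : IsOpen G) : LowerSemicontinuous fun z => M.q z G :=
    lowerSemicontinuous_measure_of_continuous_integral (fun _ => inferInstance) hW2 hG
  have hV := lowerSemicontinuous_liminf_prod
    (fun n => discRel M C (ENNReal.ofReal (a n)))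
  have hlim : Tendsto (fun n => ENNReal.ofReal (a n)) atTop (𝓝 1) := by
    simpa using ENNReal.tendsto_ofReal hatend
  refine exists_measurable_le_of_infCompact (f := fun x b => C (x, b)
    + ∫⁻ y, liminf (fun p : ℕ × X => discRel M C (ENNReal.ofReal (a p.1)) p.2)
          ((atTop : Filter ℕ) ×ˢ 𝓝 y) ∂M.q (x, b))
    (fun K hK r hr => isCompact_sublevel_add_lintegral hC hμ hV hK hr)
    (hV.measurable.const_add _) (fun x => (ENNReal.add_ne_top.2 ⟨hW, hU x⟩).lt_top)
    fun x r hr => ?_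
  refine exists_lintegral_liminf_le hC hμ
    (fun m n hmn => ENNReal.ofReal_le_ofReal (hamono hmn)) hlim
    (fun n x => iInf_le_discRel hCm ?_ (hm n) x) hr
  rw [← ENNReal.ofReal_add (ha n).1 (by linarith [(ha n).2])]
  simp

end AverageOptimality

/-- Theorem 3.2. Under Assumptions W* and B̲_{{α_n}}, with
`u(x) := liminf_{n→∞, y→x} u_{α_n}(y)`, there exists a deterministic policy `φ`
satisfying the WACOI with this `u`; consequently `φ` is average-cost optimal, `u` is
lower semicontinuous, and `w(x) = w^φ(x) = limsup_n (1-α_n) v_{α_n}(x)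
= limsup_{α↑1} (1-α) v_α(x) = w̄ = w̄_{{α_n}} = w*` for all `x`. -/
theorem statement1
    (M : MDP X A)
    (hW1 : AssumptionWi M) (hW2 : AssumptionWii M)
    (a : ℕ → ℝ)
    (ha : ∀ n, a n ∈ Set.Ico (0 : ℝ) 1) (hamono : Monotone a)
    (hatend : Tendsto a atTop (𝓝 (1 : ℝ)))
    (hB1 : wStar M < ⊤)
    (hB2 : ∀ x, Filter.liminf (fun n => uDisc M (a n) x) atTop < ⊤) :
    ∃ (φ : X → A) (hφ : Measurable φ),
      (∀ x, M.c x (φ x) + eInt (M.q (x, φ x)) (uEqnOne M a)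
        ≤ wBar M + uEqnOne M a x)
      ∧ (∀ x, avgCost M (detPolicy φ hφ) x = avgOpt M x)
      ∧ LowerSemicontinuous (uEqnOne M a)
      ∧ (∀ x, avgOpt M x = wStar M
          ∧ avgCost M (detPolicy φ hφ) x = wStar M
          ∧ Filter.limsup (fun n => ((1 - a n : ℝ) : EReal) * vDiscOpt M (a n) x) atTop = wStar M
          ∧ Filter.limsup (fun α : ℝ => ((1 - α : ℝ) : EReal) * vDiscOpt M α x)
              (𝓝[Set.Ico (0 : ℝ) 1] 1) = wStar M)
      ∧ wBar M = wStar M ∧ wBarSeq M a = wStar M := by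
  obtain ⟨k, hk₀⟩ := M.c_ne_bot
  set C := shiftedCost M k
  have hCm : Measurable C := measurable_shiftedCost M k
  have hk : ∀ z, (C z : EReal) + k = M.c z.1 z.2 := coe_shiftedCost_add hk₀
  have hE := monotone_coe_add_const k
  set m : ℝ → ℝ≥0∞ := fun r => ⨅ x, discVal M C (ENNReal.ofReal r) x
  set W : ℝ≥0∞ := limsup (fun n => ENNReal.ofReal (1 - a n) * m (a n)) atTop
  set Wbar : ℝ≥0∞ := limsup (fun r : ℝ => ENNReal.ofReal (1 - r) * m r) (𝓝[Ico (0 : ℝ) 1] 1)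
  set w₀ : ℝ≥0∞ := ⨅ x, ⨅ p, averageCost M C p x
  have hw₀ : w₀ ≠ ⊤ := by
    intro h
    rw [wStar_eq_coe_add hCm hk] at hB1
    change (w₀ : EReal) + k < ⊤ at hB1
    simp [h] at hB1
  have hm {r : ℝ} (hr : r ∈ Ico (0 : ℝ) 1) : m r ≠ ⊤ := iInf_discVal_ne_top hw₀ hr
  have hWbar : Wbar ≤ w₀ := limsup_iInf_discVal_le
  have hWWbar : W ≤ Wbar :=
    limsup_comp_le_of_tendsto (f := fun r => ENNReal.ofReal (1 - r) * m r) ha hatend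
  set U : ℕ → X → ℝ≥0∞ := fun n => discRel M C (ENNReal.ofReal (a n))
  set V : X → ℝ≥0∞ := fun x =>
    liminf (fun p : ℕ × X => U p.1 p.2) ((atTop : Filter ℕ) ×ˢ 𝓝 x)
  have hu (n : ℕ) (x : X) : uDisc M (a n) x = U n x := uDisc_eq_coe hCm hk (ha n) (hm (ha n)) x
  have hV (x : X) : uEqnOne M a x = V x := by
    simp_rw [uEqnOne, hu]
    exact liminf_coe _
  have hVlsc : LowerSemicontinuous V := lowerSemicontinuous_liminf_prod U
  have hVtop (x : X) : V x ≠ ⊤ := by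
    have h := hB2 x
    simp_rw [hu] at h
    rw [liminf_coe] at h
    have h' : liminf (fun n => U n x) atTop < ⊤ := by
      rwa [← EReal.coe_ennreal_top, EReal.coe_ennreal_lt_coe_ennreal_iff] at h
    exact ((liminf_prod_nhds_le U x).trans_lt h').ne
  obtain ⟨φ, hφ, hφV⟩ := exists_measurable_add_lintegral_liminf_le
    (fun K hK r hr => hW1.isCompact_sublevel hk hK hr) hCm hW2 ha hamono hatend
    (fun n => hm (ha n)) (ne_top_of_le_ne_top hw₀ (hWWbar.trans hWbar)) hVtop
  have hφW (x : X) : averageCost M C (detPolicy φ hφ) x ≤ W :=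
    averageCost_le_of_sum_le (hVtop x) fun N =>
      le_self_add.trans (sum_stageCost_le hφ hCm hVlsc.measurable hφV x N)
  have hopt (x : X) : ⨅ p, averageCost M C p x ≤ averageCost M C (detPolicy φ hφ) x :=
    iInf_le _ _
  have hw₀x (x : X) : w₀ ≤ ⨅ p, averageCost M C p x := iInf_le _ x
  have hX : Nonempty X := by
    by_contra hX
    rw [not_nonempty_iff] at hX
    exact hw₀ (iInf_of_empty _)
  have hW : W = w₀ := le_antisymm (hWWbar.trans hWbar)
    (((hw₀x hX.some).trans (hopt _)).trans (hφW _))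
  have hWbar' : Wbar = w₀ := le_antisymm hWbar (hW ▸ hWWbar)
  have hφw₀ (x : X) : averageCost M C (detPolicy φ hφ) x = w₀ :=
    le_antisymm ((hφW x).trans_eq hW) ((hw₀x x).trans (hopt x))
  have hAw₀ (x : X) : ⨅ p, averageCost M C p x = w₀ :=
    le_antisymm ((hopt x).trans_eq (hφw₀ x)) (hw₀x x)
  have hdisc (x : X) :
      limsup (fun r : ℝ => ENNReal.ofReal (1 - r) * discVal M C (ENNReal.ofReal r) x)
        (𝓝[Ico (0 : ℝ) 1] 1) ≤ w₀ :=
    (limsup_discVal_le_averageCost (detPolicy φ hφ) x).trans_eq (hφw₀ x)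
  have hdiscSeq (x : X) :
      limsup (fun n => ENNReal.ofReal (1 - a n) * discVal M C (ENNReal.ofReal (a n)) x) atTop
        ≤ limsup (fun r : ℝ => ENNReal.ofReal (1 - r) * discVal M C (ENNReal.ofReal r) x)
          (𝓝[Ico (0 : ℝ) 1] 1) :=
    limsup_comp_le_of_tendsto
      (f := fun r => ENNReal.ofReal (1 - r) * discVal M C (ENNReal.ofReal r) x) ha hatend
  have hWdisc (x : X) :
      W ≤ limsup (fun n => ENNReal.ofReal (1 - a n) * discVal M C (ENNReal.ofReal (a n)) x)
        atTop :=
    limsup_le_limsup (Eventually.of_forall fun n => mul_le_mul_right (iInf_le _ x) _)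
  have havg (x : X) : avgCost M (detPolicy φ hφ) x = wStar M := by
    rw [avgCost_eq_coe_add hCm hk, wStar_eq_coe_add hCm hk, hφw₀]
  have havgOpt (x : X) : avgOpt M x = wStar M := by
    rw [avgOpt_eq_coe_add hCm hk, wStar_eq_coe_add hCm hk, hAw₀]
  refine ⟨φ, hφ, fun x => ?_, fun x => (havg x).trans (havgOpt x).symm, ?_,
    fun x => ⟨havgOpt x, havg x, ?_, ?_⟩, ?_, ?_⟩
  · rw [wBar_eq_coe_add hCm hk, funext hV, eInt_coe, ← hk (x, φ x)]
    change (C (x, φ x) : EReal) + k + ((∫⁻ y, V y ∂M.q (x, φ x) : ℝ≥0∞) : EReal)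
      ≤ (Wbar : EReal) + k + (V x : EReal)
    rw [add_right_comm (C (x, φ x) : EReal), add_right_comm (Wbar : EReal),
      ← EReal.coe_ennreal_add, ← EReal.coe_ennreal_add]
    exact hE ((hφV x).trans (add_le_add_left hWWbar _))
  · rw [funext hV]
    exact continuous_coe_ennreal_ereal.comp_lowerSemicontinuous hVlsc
      EReal.coe_ennreal_strictMono.monotone
  · rw [limsup_seq_vDiscOpt_eq_coe_add hCm hk ha, wStar_eq_coe_add hCm hk,
      le_antisymm ((hdiscSeq x).trans (hdisc x)) (hW ▸ hWdisc x)]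
  · rw [limsup_vDiscOpt_eq_coe_add hCm hk, wStar_eq_coe_add hCm hk,
      le_antisymm (hdisc x) (hW ▸ (hWdisc x).trans (hdiscSeq x))]
  · rw [wBar_eq_coe_add hCm hk, wStar_eq_coe_add hCm hk]
    exact congrArg (fun s : ℝ≥0∞ => (s : EReal) + k) hWbar'
  · rw [wBarSeq_eq_coe_add hCm hk ha, wStar_eq_coe_add hCm hk]
    exact congrArg (fun s : ℝ≥0∞ => (s : EReal) + k) hW

end Statements

end
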